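/- arXiv:math/0701733 — 3 statements merged into one kernel-verified Lean document; each statement's English description precedes it below -/
import Mathlib

section
/- The generating function h_m(x) for Dyck paths with k-ascents coloured by Dyck paths of length 2k having ascents of length at most m satisfies h_m(x) - 1 = x*h_m(x)^3 - (x*h_m(x)^2)^{m+1}. -/
open Finset PowerSeries

/-- A Dyck word: list of booleans (`true` = up-step, `false` = down-step),
with equally many up- and down-steps, never going below the x-axis. -/
def IsDyckWord (p : List Bool) : Prop :=
  (∀ k, (p.take k).count false ≤ (p.take k).count true) ∧
    p.count true = p.count false

/-- The lengths of the maximal runs of up-steps (ascents) of a path, in order. -/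
def ascentLengths (p : List Bool) : List ℕ :=
  ((p.splitOn false).map List.length).filter (fun k => 0 < k)

/-- Dyck paths of semilength `n` together with a colour for each ascent,
where a `k`-ascent may receive any colour `c` with `L k c`. -/
def ColouredDyck {α : Type*} (n : ℕ) (L : ℕ → α → Prop) :
    Set (List Bool × List α) :=
  {pc | IsDyckWord pc.1 ∧ pc.1.length = 2 * n ∧
    pc.2.length = (ascentLengths pc.1).length ∧
    ∀ q ∈ (ascentLengths pc.1).zip pc.2, L q.1 q.2}

theorem eq_zero_of_forall_X_pow_dvd {f : ℚ⟦X⟧} (M : ℕ)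
    (h : ∀ N, M ≤ N → (X : ℚ⟦X⟧) ^ N ∣ f) : f = 0 := by
  ext n
  exact X_pow_dvd_iff.1 (h (n + 1 + M) (by omega)) n (by omega)

/-- A sequence of power series satisfying the first-return recursion consists of powers. -/
theorem eq_pow_of_recursion {a : ℕ → ℚ} {T : ℕ → ℚ⟦X⟧} (ha : a 0 = 1) (h0 : T 0 = 1)
    (hT : ∀ j N, (X : ℚ⟦X⟧) ^ N ∣
      T (j + 1) - ∑ k ∈ range N, C (a k) * X ^ k * T (j + k)) (j : ℕ) :
    T j = T 1 ^ j := by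
  have key : ∀ N j, (X : ℚ⟦X⟧) ^ N ∣ T (j + 1) - T 1 * T j := by
    intro N
    induction N with
    | zero => simp
    | succ N ih =>
      intro j
      induction j with
      | zero => simp [h0]
      | succ j ihj =>
        have h1 := dvd_sub (hT (j + 1) (N + 1)) ((hT j (N + 1)).mul_left (T 1))
        have h2 : (X : ℚ⟦X⟧) ^ (N + 1) ∣
            ∑ k ∈ range (N + 1), C (a k) * X ^ k * (T (j + k + 1) - T 1 * T (j + k)) := by
          refine Finset.dvd_sum fun k _ => ?_
          rcases k with _ | k
          · simpa [ha] using ihj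
          · rw [pow_succ', pow_succ', mul_assoc, mul_assoc]
            exact (mul_dvd_mul_left _ ((ih _).mul_left _)).mul_left _
        convert dvd_add h1 h2 using 1
        rw [mul_sub, Finset.mul_sum]
        simp_rw [mul_sub, Finset.sum_sub_distrib]
        have e1 : ∀ k, C (a k) * X ^ k * T (j + 1 + k) = C (a k) * X ^ k * T (j + k + 1) := by
          intro k; rw [add_right_comm]
        have e2 : ∀ k, T 1 * (C (a k) * X ^ k * T (j + k)) = C (a k) * X ^ k * (T 1 * T (j + k)) := by
          intro k; ring
        simp_rw [e1, e2]
        ring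
  induction j with
  | zero => simpa using h0
  | succ j ih =>
    rw [pow_succ', ← ih]
    exact sub_eq_zero.1 (eq_zero_of_forall_X_pow_dvd 0 fun N _ => key N j)

/-- Substituting `X * H` into a functional equation of `A`. -/
theorem functional_equation_comp {m : ℕ} {A H : ℚ⟦X⟧}
    (hA : A = ∑ i ∈ range (m + 1), (X * A) ^ i)
    (hH : ∀ N, (X : ℚ⟦X⟧) ^ N ∣ H - ∑ k ∈ range N, C (coeff k A) * (X * H) ^ k) :
    H = ∑ i ∈ range (m + 1), (X * H ^ 2) ^ i := by
  refine sub_eq_zero.1 (eq_zero_of_forall_X_pow_dvd 0 fun N _ => ?_)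
  set p : Polynomial ℚ := trunc N A with hp
  have hpA : (X : ℚ⟦X⟧) ^ N ∣ A - p := by
    rw [X_pow_dvd_iff]
    intro n hn
    simp [hp, coeff_trunc, hn]
  have hsum : ∀ (u v w : ℚ⟦X⟧), (X : ℚ⟦X⟧) ^ N ∣ u - v → (X : ℚ⟦X⟧) ^ N ∣
      ∑ i ∈ range (m + 1), (w * u) ^ i - ∑ i ∈ range (m + 1), (w * v) ^ i := by
    intro u v w huv
    rw [← Finset.sum_sub_distrib]
    refine Finset.dvd_sum fun i _ => (dvd_trans ?_ (sub_dvd_pow_sub_pow _ _ i))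
    rw [← mul_sub]
    exact huv.mul_left _
  have hpp : (Polynomial.X : Polynomial ℚ) ^ N ∣
      p - ∑ i ∈ range (m + 1), (Polynomial.X * p) ^ i := by
    have h1 := dvd_sub (hsum A p X hpA) hpA
    rw [← hA] at h1
    have h2 : (X : ℚ⟦X⟧) ^ N ∣ p - ∑ i ∈ range (m + 1), (X * (p : ℚ⟦X⟧)) ^ i := by
      convert h1 using 1; ring
    rw [Polynomial.X_pow_dvd_iff]
    intro d hd
    have := X_pow_dvd_iff.1 h2 d hd
    rw [← Polynomial.coeff_coe, ← this]
    congr 1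
    have e := map_sum (Polynomial.coeToPowerSeries.ringHom (R := ℚ))
      (fun i => (Polynomial.X * p) ^ i) (range (m + 1))
    simp only [Polynomial.coeToPowerSeries.ringHom_apply] at e
    simp [e]
  obtain ⟨q, hq⟩ := hpp
  have hq' := congrArg (Polynomial.aeval (X * H)) hq
  have hpe : Polynomial.aeval (X * H) p = ∑ k ∈ range N, C (coeff k A) * (X * H) ^ k := by
    exact eval₂_trunc_eq_sum_range _ _ _ _
  simp only [map_sub, map_sum, map_pow, map_mul, Polynomial.aeval_X] at hq'
  have h3 : (X : ℚ⟦X⟧) ^ N ∣ Polynomial.aeval (X * H) p -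
      ∑ i ∈ range (m + 1), (X * H * Polynomial.aeval (X * H) p) ^ i := by
    rw [hq', mul_pow, mul_assoc]
    exact dvd_mul_right _ _
  have h4 := hH N
  rw [← hpe] at h4
  have h5 := dvd_sub (dvd_add h3 h4) (hsum _ _ (X * H) h4)
  convert h5 using 1
  have : ∀ i, (X * H ^ 2) ^ i = (X * H * H) ^ i := by intro i; ring
  simp_rw [this]
  ring

theorem ascentLengths_replicate (i : ℕ) :
    ascentLengths (List.replicate i true) = if i = 0 then [] else [i] := by
  unfold ascentLengths
  rw [List.splitOn_eq_singleton (by simp)]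
  rcases i with _ | i <;> simp

theorem ascentLengths_replicate_append_false (i : ℕ) (p : List Bool) :
    ascentLengths (List.replicate i true ++ false :: p) =
      (if i = 0 then [] else [i]) ++ ascentLengths p := by
  unfold ascentLengths
  rw [List.splitOn_append_cons_self_of_not_mem (by simp)]
  rcases i with _ | i <;> simp

theorem replicate_append_true (i : ℕ) (p : List Bool) :
    List.replicate i true ++ true :: p = List.replicate (i + 1) true ++ p := by
  rw [List.replicate_succ']; simp

/-- `p` is a path from height `h` to height `0` that never goes below the x-axis. -/
def IsPathFrom (h : ℕ) (p : List Bool) : Prop :=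
  (∀ k, (p.take k).count false ≤ h + (p.take k).count true) ∧
    h + p.count true = p.count false

theorem isPathFrom_zero_iff {p : List Bool} : IsPathFrom 0 p ↔ IsDyckWord p := by
  simp [IsPathFrom, IsDyckWord]

theorem isPathFrom_nil_iff {h : ℕ} : IsPathFrom h [] ↔ h = 0 := by
  simp [IsPathFrom]

theorem isPathFrom_true_cons_iff {h : ℕ} {p : List Bool} :
    IsPathFrom h (true :: p) ↔ IsPathFrom (h + 1) p := by
  unfold IsPathFrom
  refine and_congr ⟨fun H k => ?_, fun H k => ?_⟩ ?_
  · have := H (k + 1)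
    simp at this
    omega
  · rcases k with _ | k
    · simp
    · have := H k
      simp
      omega
  · simp
    omega

theorem isPathFrom_zero_false_cons {p : List Bool} : ¬ IsPathFrom 0 (false :: p) := by
  intro H
  have := H.1 1
  simp at this

theorem isPathFrom_succ_false_cons_iff {h : ℕ} {p : List Bool} :
    IsPathFrom (h + 1) (false :: p) ↔ IsPathFrom h p := by
  unfold IsPathFrom
  refine and_congr ⟨fun H k => ?_, fun H k => ?_⟩ ?_
  · have := H (k + 1)
    simp at this
    omega
  · rcases k with _ | k
    · simp
    · have := H k
      simp
      omega
  · simp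
    omega

/-- Coloured paths of length `l` from height `h` to `0`, preceded by `i` up-steps. -/
def colouredSuffixes {α : Type*} (L : ℕ → α → Prop) (l i h : ℕ) : Set (List Bool × List α) :=
  {pc | IsPathFrom h pc.1 ∧ pc.1.length = l ∧
    pc.2.length = (ascentLengths (List.replicate i true ++ pc.1)).length ∧
    ∀ q ∈ (ascentLengths (List.replicate i true ++ pc.1)).zip pc.2, L q.1 q.2}

theorem colouredDyck_eq_colouredSuffixes {α : Type*} (L : ℕ → α → Prop) (n : ℕ) :
    ColouredDyck n L = colouredSuffixes L (2 * n) 0 0 := by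
  simp [ColouredDyck, colouredSuffixes, isPathFrom_zero_iff]

/-- The number of colours of an ascent of length `k`; the absent ascent has one colour. -/
noncomputable def colourCount {α : Type*} (L : ℕ → α → Prop) (k : ℕ) : ℕ :=
  if k = 0 then 1 else {c | L k c}.ncard

/-- The weighted count of paths of length `l` from height `h` to `0`,
preceded by `i` up-steps. -/
def suffixWeight (a : ℕ → ℕ) : ℕ → ℕ → ℕ → ℕ
  | 0, i, 0 => a i
  | 0, _, _ + 1 => 0
  | l + 1, i, 0 => suffixWeight a l (i + 1) 1
  | l + 1, i, h + 1 => suffixWeight a l (i + 1) (h + 2) + a i * suffixWeight a l 0 h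

/-- The weighted count of paths of length `l` from height `h` to `0`
that do not start with an up-step. -/
def descentWeight (a : ℕ → ℕ) : ℕ → ℕ → ℕ
  | 0, 0 => 1
  | h + 1, l + 1 => suffixWeight a l 0 h
  | 0, _ + 1 => 0
  | _ + 1, 0 => 0

theorem suffixWeight_zero (a : ℕ → ℕ) (i h : ℕ) :
    suffixWeight a 0 i h = a i * descentWeight a h 0 := by
  cases h <;> simp [suffixWeight, descentWeight]

theorem suffixWeight_succ (a : ℕ → ℕ) (l i h : ℕ) :
    suffixWeight a (l + 1) i h =
      suffixWeight a l (i + 1) (h + 1) + a i * descentWeight a h (l + 1) := by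
  cases h <;> simp [suffixWeight, descentWeight]

theorem suffixWeight_eq_sum (a : ℕ → ℕ) (l i h : ℕ) :
    suffixWeight a l i h =
      ∑ k ∈ range (l + 1), a (i + k) * descentWeight a (h + k) (l - k) := by
  induction l generalizing i h with
  | zero => simp [suffixWeight_zero]
  | succ l ih =>
    rw [suffixWeight_succ, ih, Finset.sum_range_succ' _ (l + 1)]
    simp [add_assoc, add_comm 1]

theorem suffixWeight_eq_zero (a : ℕ → ℕ) {l h : ℕ} (i : ℕ) (hl : l < h) :
    suffixWeight a l i h = 0 := by
  induction l generalizing i h with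
  | zero =>
    obtain ⟨h, rfl⟩ := Nat.exists_eq_add_of_lt hl
    simp [suffixWeight]
  | succ l ih =>
    obtain ⟨h, rfl⟩ : ∃ h', h = h' + 1 := ⟨h - 1, by omega⟩
    simp [suffixWeight, ih _ (show l < h + 2 by omega), ih _ (show l < h by omega)]

theorem descentWeight_eq_zero (a : ℕ → ℕ) {l h : ℕ} (hl : l < h) : descentWeight a h l = 0 := by
  cases h <;> cases l <;> simp_all [descentWeight, suffixWeight_eq_zero]

/-- The generating function of `descentWeight` by the number of up-steps. -/
noncomputable def descentSeries (a : ℕ → ℕ) (h : ℕ) : ℚ⟦X⟧ :=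
  PowerSeries.mk fun n => (descentWeight a h (2 * n + h) : ℚ)

theorem descentSeries_zero (a : ℕ → ℕ) : descentSeries a 0 = 1 := by
  ext n
  cases n <;> simp [descentSeries, descentWeight, coeff_one, Nat.mul_succ]

theorem descentSeries_recursion (a : ℕ → ℕ) (j N : ℕ) : (X : ℚ⟦X⟧) ^ N ∣
    descentSeries a (j + 1) - ∑ k ∈ range N, C (a k : ℚ) * X ^ k * descentSeries a (j + k) := by
  rw [X_pow_dvd_iff]
  intro n hn
  have hterm : ∀ k, coeff n (C (a k : ℚ) * X ^ k * descentSeries a (j + k)) =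
      ((a k * descentWeight a (j + k) (2 * n + j - k) : ℕ) : ℚ) := by
    intro k
    rw [mul_assoc, coeff_C_mul, coeff_X_pow_mul']
    split_ifs with hk
    · rw [descentSeries, coeff_mk, show 2 * (n - k) + (j + k) = 2 * n + j - k by omega]
      push_cast
      rfl
    · rw [descentWeight_eq_zero a (by omega)]
      simp
  rw [map_sub, map_sum, Finset.sum_congr rfl fun k _ => hterm k, ← Nat.cast_sum, descentSeries,
    coeff_mk, sub_eq_zero, ← add_assoc, descentWeight, suffixWeight_eq_sum]
  congr 1
  simp only [zero_add]
  have h1 : ∀ M, n < M → ∑ k ∈ range M, a k * descentWeight a (j + k) (2 * n + j - k) =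
      ∑ k ∈ range (n + 1), a k * descentWeight a (j + k) (2 * n + j - k) := by
    intro M hM
    refine (Finset.sum_subset (by simpa using hM) fun k _ hk => ?_).symm
    rw [descentWeight_eq_zero a (by simp at hk; omega), mul_zero]
  rw [h1 _ (by omega), h1 _ hn]

theorem colouredSuffixes_zero {α : Type*} {L : ℕ → α → Prop} (i : ℕ) :
    colouredSuffixes L 0 i 0 =
      if i = 0 then {([], [])} else (fun c => ([], [c])) '' {c | L i c} := by
  ext ⟨p, cs⟩
  simp only [colouredSuffixes, Set.mem_ofPred_eq, List.length_eq_zero_iff]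
  constructor
  · rintro ⟨-, rfl, h1, h2⟩
    simp only [List.append_nil, ascentLengths_replicate] at h1 h2
    split_ifs at h1 h2 ⊢ with hi
    · simpa using h1
    · obtain ⟨c, rfl⟩ := List.length_eq_one_iff.1 h1
      simpa using h2
  · intro H
    split_ifs at H with hi
    · obtain ⟨rfl, rfl⟩ := Prod.mk.inj H
      simp [hi, isPathFrom_nil_iff, show ascentLengths [] = [] from rfl]
    · obtain ⟨c, hc, hcs⟩ := H
      obtain ⟨rfl, rfl⟩ := Prod.mk.inj hcs
      simpa [isPathFrom_nil_iff, ascentLengths_replicate, hi] using hc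

theorem colouredSuffixes_zero_succ {α : Type*} {L : ℕ → α → Prop} (i h : ℕ) :
    colouredSuffixes L 0 i (h + 1) = ∅ := by
  ext ⟨p, cs⟩
  simp only [colouredSuffixes, Set.mem_ofPred_eq, List.length_eq_zero_iff, Set.mem_empty_iff_false,
    iff_false]
  rintro ⟨h1, rfl, -⟩
  simp [isPathFrom_nil_iff] at h1

/-- The coloured suffixes starting with a down-step, in terms of the remaining path. -/
def downSuffixes {α : Type*} (L : ℕ → α → Prop) (l i : ℕ) : ℕ → Set (List Bool × List α)
  | 0 => ∅
  | h + 1 =>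
    if i = 0 then Prod.map (List.cons false) id '' colouredSuffixes L l 0 h
    else (fun x : α × (List Bool × List α) => (false :: x.2.1, x.1 :: x.2.2)) ''
      ({c | L i c} ×ˢ colouredSuffixes L l 0 h)

theorem colouredSuffixes_succ {α : Type*} {L : ℕ → α → Prop} (l i h : ℕ) :
    colouredSuffixes L (l + 1) i h =
      Prod.map (List.cons true) id '' colouredSuffixes L l (i + 1) (h + 1) ∪
        downSuffixes L l i h := by
  ext ⟨p, cs⟩
  rcases p with _ | ⟨b, p⟩
  · rcases h with _ | h
    · simp [colouredSuffixes, downSuffixes]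
    · by_cases hi : i = 0 <;> simp [colouredSuffixes, downSuffixes, hi]
  rcases b with _ | _
  · rcases h with _ | h
    · simp [colouredSuffixes, downSuffixes, isPathFrom_zero_false_cons]
    · by_cases hi : i = 0
      · simp [colouredSuffixes, downSuffixes, hi, isPathFrom_succ_false_cons_iff,
          show ascentLengths (false :: p) = ascentLengths p by
            simpa using ascentLengths_replicate_append_false 0 p]
      · rcases cs with _ | ⟨c, cs⟩
        · simp [colouredSuffixes, downSuffixes, hi, isPathFrom_succ_false_cons_iff,
            ascentLengths_replicate_append_false]
        · simp [colouredSuffixes, downSuffixes, hi, isPathFrom_succ_false_cons_iff,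
            ascentLengths_replicate_append_false, or_imp, forall_and]
          tauto
  · rcases h with _ | h
    · simp [colouredSuffixes, downSuffixes, isPathFrom_true_cons_iff, replicate_append_true]
    · by_cases hi : i = 0 <;> simp [colouredSuffixes, downSuffixes, hi, isPathFrom_true_cons_iff,
        replicate_append_true]

theorem disjoint_downSuffixes {α : Type*} {L : ℕ → α → Prop} (S : Set (List Bool × List α))
    (l i h : ℕ) : Disjoint (Prod.map (List.cons true) id '' S) (downSuffixes L l i h) := by
  rw [Set.disjoint_left]
  rintro _ ⟨x, -, rfl⟩ H
  rcases h with _ | h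
  · exact H
  · by_cases hi : i = 0 <;> simp [downSuffixes, hi, Prod.map] at H

theorem colouredSuffixes_finite_and_ncard {α : Type*} {L : ℕ → α → Prop}
    (hL : ∀ k, {c | L k c}.Finite) (l i h : ℕ) :
    (colouredSuffixes L l i h).Finite ∧
      (colouredSuffixes L l i h).ncard = suffixWeight (colourCount L) l i h := by
  induction l generalizing i h with
  | zero =>
    rcases h with _ | h
    · rw [colouredSuffixes_zero, suffixWeight, colourCount]
      split_ifs with hi
      · simp
      · exact ⟨(hL i).image _, Set.ncard_image_of_injective _ fun c d => by simp⟩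
    · simp [colouredSuffixes_zero_succ, suffixWeight]
  | succ l ih =>
    have hdown : (downSuffixes L l i h).Finite ∧ (downSuffixes L l i h).ncard =
        colourCount L i * descentWeight (colourCount L) h (l + 1) := by
      rcases h with _ | h
      · simp [downSuffixes, descentWeight]
      · rw [downSuffixes, descentWeight, colourCount, ← (ih 0 h).2]
        split_ifs with hi
        · refine ⟨(ih 0 h).1.image _, ?_⟩
          rw [Set.ncard_image_of_injective, one_mul]
          exact List.cons_injective.prodMap Function.injective_id
        · refine ⟨((hL i).prod (ih 0 h).1).image _, ?_⟩
          rw [Set.ncard_image_of_injective, Set.ncard_prod]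
          rintro ⟨c, p, cs⟩ ⟨c', p', cs'⟩ H
          simp_all
    have hup := ih (i + 1) (h + 1)
    rw [colouredSuffixes_succ, suffixWeight_succ, ← hdown.2, ← hup.2]
    refine ⟨(hup.1.image _).union hdown.1, ?_⟩
    rw [Set.ncard_union_eq (disjoint_downSuffixes _ l i h) (hup.1.image _) hdown.1,
      Set.ncard_image_of_injective]
    exact List.cons_injective.prodMap Function.injective_id

theorem colouredDyck_finite {α : Type*} {L : ℕ → α → Prop} (hL : ∀ k, {c | L k c}.Finite)
    (n : ℕ) : (ColouredDyck n L).Finite := by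
  rw [colouredDyck_eq_colouredSuffixes]
  exact (colouredSuffixes_finite_and_ncard hL _ _ _).1

/-- The generating function of coloured Dyck paths. -/
noncomputable def colouredDyckSeries {α : Type*} (L : ℕ → α → Prop) : ℚ⟦X⟧ :=
  PowerSeries.mk fun n => (Nat.card (ColouredDyck n L) : ℚ)

theorem colouredDyckSeries_eq_descentSeries {α : Type*} {L : ℕ → α → Prop}
    (hL : ∀ k, {c | L k c}.Finite) :
    colouredDyckSeries L = descentSeries (colourCount L) 1 := by
  ext n
  rw [colouredDyckSeries, descentSeries, coeff_mk, coeff_mk, Nat.card_coe_set_eq,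
    colouredDyck_eq_colouredSuffixes, (colouredSuffixes_finite_and_ncard hL _ _ _).2, descentWeight]

theorem colouredDyckSeries_functional_equation {α : Type*} {L : ℕ → α → Prop}
    (hL : ∀ k, {c | L k c}.Finite) (N : ℕ) : (X : ℚ⟦X⟧) ^ N ∣
      colouredDyckSeries L -
        ∑ k ∈ range N, C (colourCount L k : ℚ) * (X * colouredDyckSeries L) ^ k := by
  have hrec := descentSeries_recursion (colourCount L)
  have hpow := eq_pow_of_recursion (a := fun k => (colourCount L k : ℚ)) (by simp [colourCount])
    (descentSeries_zero _) hrec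
  have := hrec 0 N
  rw [colouredDyckSeries_eq_descentSeries hL]
  simp only [zero_add] at this
  convert this using 3 with k
  rw [hpow k, mul_pow, mul_assoc]

/-- Dyck words of semilength `n` whose ascents have length at most `m`. -/
def boundedDyckWords (m n : ℕ) : Set (List Bool) :=
  {c | IsDyckWord c ∧ c.length = 2 * n ∧ ∀ j ∈ ascentLengths c, j ≤ m}

theorem boundedDyckWords_eq_image (m n : ℕ) :
    boundedDyckWords m n = Prod.fst '' ColouredDyck n (fun k (_ : Unit) => k ≤ m) := by
  ext p
  constructor
  · rintro ⟨h1, h2, h3⟩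
    refine ⟨(p, List.replicate (ascentLengths p).length ()), ⟨h1, h2, by simp, ?_⟩, rfl⟩
    rintro ⟨j, u⟩ hq
    exact h3 j (List.of_mem_zip hq).1
  · rintro ⟨⟨p, cs⟩, ⟨h1, h2, h3, h4⟩, rfl⟩
    refine ⟨h1, h2, fun j hj => ?_⟩
    obtain ⟨t, ht, rfl⟩ := List.getElem_of_mem hj
    have ht' : t < cs.length := by simpa [h3] using ht
    have hz : t < ((ascentLengths p).zip cs).length := by simp [ht, ht']
    have := h4 _ (List.getElem_mem hz)
    simpa using this

theorem boundedDyckWords_finite (m n : ℕ) : (boundedDyckWords m n).Finite := by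
  rw [boundedDyckWords_eq_image]
  exact (colouredDyck_finite (fun k => Set.toFinite _) n).image _

theorem ncard_boundedDyckWords (m n : ℕ) : (boundedDyckWords m n).ncard =
    Nat.card (ColouredDyck n (fun k (_ : Unit) => k ≤ m)) := by
  rw [boundedDyckWords_eq_image, Nat.card_coe_set_eq]
  refine Set.InjOn.ncard_image ?_
  rintro ⟨p, cs⟩ h ⟨p', cs'⟩ h' rfl
  have : cs.length = cs'.length := h.2.2.1.trans h'.2.2.1.symm
  exact Prod.ext rfl (List.ext_getElem this fun _ _ _ => rfl)

theorem boundedDyckSeries_functional_equation (m : ℕ) :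
    colouredDyckSeries (fun k (_ : Unit) => k ≤ m) = ∑ i ∈ range (m + 1),
      (X * colouredDyckSeries (fun k (_ : Unit) => k ≤ m)) ^ i := by
  refine sub_eq_zero.1 (eq_zero_of_forall_X_pow_dvd (m + 1) fun N hN => ?_)
  have := colouredDyckSeries_functional_equation (L := fun k (_ : Unit) => k ≤ m)
    (fun k => Set.toFinite _) N
  convert this using 2
  have hcount : ∀ k, colourCount (fun k (_ : Unit) => k ≤ m) k = if k ≤ m then 1 else 0 := by
    intro k
    rcases k with _ | k
    · simp [colourCount]
    · by_cases hk : k + 1 ≤ m <;> simp [colourCount, hk, Set.ncard_univ]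
  rw [← Finset.sum_subset (Finset.range_subset_range.2 hN)]
  · refine Finset.sum_congr rfl fun k hk => ?_
    rw [hcount, if_pos (by simp at hk; omega)]
    simp
  · intro k _ hk
    rw [hcount, if_neg (by simp at hk; omega)]
    simp

theorem coeff_boundedDyckSeries (m k : ℕ) :
    coeff k (colouredDyckSeries (fun k (_ : Unit) => k ≤ m)) =
      (colourCount (fun k c => c ∈ boundedDyckWords m k) k : ℚ) := by
  rw [colouredDyckSeries, coeff_mk, ← ncard_boundedDyckWords]
  rcases k with _ | k
  · have : boundedDyckWords m 0 = {[]} := by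
      ext p
      simp only [boundedDyckWords, mul_zero, List.length_eq_zero_iff, Set.mem_ofPred_eq,
        Set.mem_singleton_iff]
      refine ⟨fun h => h.2.1, ?_⟩
      rintro rfl
      simp [IsDyckWord, show ascentLengths [] = [] from rfl]
    simp [colourCount, this]
  · simp [colourCount]

/-- the generating function `h_m` of Dyck paths with `k`-ascents
coloured by Dyck paths of length `2k` having ascents of length at most `m`
satisfies `h_m - 1 = x h_m³ - (x h_m²)^(m+1)`. -/
theorem coloured_dyck_bounded_gf_equation (m : ℕ) :
    (PowerSeries.mk fun n => (Nat.card (ColouredDyck n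
        (fun k c => IsDyckWord c ∧ c.length = 2 * k ∧
          ∀ j ∈ ascentLengths c, j ≤ m)) : ℚ)) - 1 =
      PowerSeries.X *
        (PowerSeries.mk fun n => (Nat.card (ColouredDyck n
          (fun k c => IsDyckWord c ∧ c.length = 2 * k ∧
            ∀ j ∈ ascentLengths c, j ≤ m)) : ℚ)) ^ 3 -
      (PowerSeries.X *
        (PowerSeries.mk fun n => (Nat.card (ColouredDyck n
          (fun k c => IsDyckWord c ∧ c.length = 2 * k ∧
            ∀ j ∈ ascentLengths c, j ≤ m)) : ℚ)) ^ 2) ^ (m + 1) := by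
  change colouredDyckSeries (fun k c => c ∈ boundedDyckWords m k) - 1 =
    X * colouredDyckSeries (fun k c => c ∈ boundedDyckWords m k) ^ 3 -
      (X * colouredDyckSeries (fun k c => c ∈ boundedDyckWords m k) ^ 2) ^ (m + 1)
  have hH := colouredDyckSeries_functional_equation (L := fun k c => c ∈ boundedDyckWords m k)
    (boundedDyckWords_finite m)
  simp_rw [← coeff_boundedDyckSeries] at hH
  have h := functional_equation_comp (boundedDyckSeries_functional_equation m) hH
  set H := colouredDyckSeries (fun k c => c ∈ boundedDyckWords m k)
  have hgeom := geom_sum_mul (X * H ^ 2) (m + 1)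
  rw [← h] at hgeom
  linear_combination -hgeom
end

section
/- The number of dissections of a convex (n+2)-gon by non-crossing diagonals into polygons each having between 3 and m+2 vertices equals sum_{l=0}^{n-1} (1/(l+1)) * binomial(n+l+1, l) * sum_{i=0}^{l+1} (-1)^i * binomial(n-1-mi, l) * binomial(l+1, i). -/
open Finset

/-- `(d.1, d.2)` is a diagonal of the convex `N`-gon with vertices
`0, 1, …, N-1` in clockwise order: its endpoints are non-adjacent. -/
def IsDiagonal {N : ℕ} (d : Fin N × Fin N) : Prop :=
  d.1 < d.2 ∧ d.1.val + 1 < d.2.val ∧ ¬(d.1.val = 0 ∧ d.2.val = N - 1)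

/-- Two chords cross iff their endpoints alternate. -/
def ChordsCross {N : ℕ} (d e : Fin N × Fin N) : Prop :=
  d.1 < e.1 ∧ e.1 < d.2 ∧ d.2 < e.2

/-- A dissection of the convex `N`-gon: a set of pairwise non-crossing
diagonals. -/
def IsDissection {N : ℕ} (D : Finset (Fin N × Fin N)) : Prop :=
  (∀ d ∈ D, IsDiagonal d) ∧ ∀ d ∈ D, ∀ e ∈ D, ¬ChordsCross d e

/-- The chord `d` separates the circle points `x` and `y`: they lie strictly on
opposite sides of it. -/
def SeparatedBy {N : ℕ} (d : Fin N × Fin N) (x y : Fin N) : Prop :=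
  x ≠ d.1 ∧ x ≠ d.2 ∧ y ≠ d.1 ∧ y ≠ d.2 ∧
    ((d.1 < x ∧ x < d.2) ↔ ¬(d.1 < y ∧ y < d.2))

/-- A cell of a dissection: a maximal set of vertices no two of which are
separated by a diagonal of the dissection. -/
def IsCell {N : ℕ} (D : Finset (Fin N × Fin N)) (C : Finset (Fin N)) : Prop :=
  (∀ x ∈ C, ∀ y ∈ C, ∀ d ∈ D, ¬SeparatedBy d x y) ∧
    ∀ C' : Finset (Fin N), C ⊆ C' →
      (∀ x ∈ C', ∀ y ∈ C', ∀ d ∈ D, ¬SeparatedBy d x y) → C' = C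

/-- Binomial coefficient `C(a, k)` with the convention that it vanishes for
negative `a`. -/
def ibin (a : ℤ) (k : ℕ) : ℚ :=
  if 0 ≤ a then (a.toNat.choose k : ℚ) else 0

section Arcs

variable {α : Type*} [LinearOrder α] [LocallyFiniteOrder α]

/-- No two chords in `D` cross. -/
def NonCrossing (D : Finset (α × α)) : Prop :=
  ∀ d ∈ D, ∀ e ∈ D, ¬(d.1 < e.1 ∧ e.1 < d.2 ∧ d.2 < e.2)

/-- The points between `x` and `y` visible from the chord `(x, y)`: those that no other chord of
`D` lying over `[x, y]` covers. -/
def cellBelow (D : Finset (α × α)) (x y : α) : Finset α :=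
  {v ∈ Icc x y | ∀ d ∈ D, x ≤ d.1 → d.2 ≤ y → d ≠ (x, y) → ¬(d.1 < v ∧ v < d.2)}

theorem mem_cellBelow {D : Finset (α × α)} {x y v : α} :
    v ∈ cellBelow D x y ↔ (x ≤ v ∧ v ≤ y) ∧
      ∀ p q, (p, q) ∈ D → x ≤ p → q ≤ y → (p, q) ≠ (x, y) → ¬(p < v ∧ v < q) := by
  simp [cellBelow]

theorem left_mem_cellBelow {D : Finset (α × α)} {x y : α} (h : x ≤ y) : x ∈ cellBelow D x y :=
  mem_cellBelow.2 ⟨⟨le_rfl, h⟩, fun _ _ _ hp _ _ hv ↦ (hp.trans_lt hv.1).false⟩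

theorem right_mem_cellBelow {D : Finset (α × α)} {x y : α} (h : x ≤ y) : y ∈ cellBelow D x y :=
  mem_cellBelow.2 ⟨⟨h, le_rfl⟩, fun _ _ _ _ hq _ hv ↦ (hq.trans_lt hv.2).false⟩

/-- The cell below a chord that is not a side has a third vertex. -/
theorem exists_mem_cellBelow_between {D : Finset (α × α)} (hD : NonCrossing D) {x y : α}
    (hxy : (Ioo x y).Nonempty) : ∃ v ∈ cellBelow D x y, x < v ∧ v < y := by
  classical
  by_cases hQ : {q ∈ Ioo x y | (x, q) ∈ D}.Nonempty
  · obtain ⟨q, hq, hmax⟩ := exists_max_image _ id hQ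
    simp only [mem_filter, mem_Ioo, id, and_imp] at hq hmax
    refine ⟨q, mem_cellBelow.2 ⟨⟨hq.1.1.le, hq.1.2.le⟩, ?_⟩, hq.1⟩
    rintro p r hpr hp hr hne ⟨hpq, hqr⟩
    rcases hp.eq_or_lt with rfl | hp
    · have hry : r ≠ y := by rintro rfl; exact hne rfl
      exact (hmax r (hq.1.1.trans hqr) (lt_of_le_of_ne hr hry) hpr).not_gt hqr
    · exact hD _ hq.2 _ hpr ⟨hp, hpq, hqr⟩
  · obtain ⟨z, hz, hmin⟩ := exists_min_image _ id hxy
    simp only [mem_Ioo, id, and_imp] at hz hmin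
    refine ⟨z, mem_cellBelow.2 ⟨⟨hz.1.le, hz.2.le⟩, ?_⟩, hz⟩
    rintro p r hpr hp hr hne ⟨hpz, hzr⟩
    rcases hp.eq_or_lt with rfl | hp
    · have hry : r ≠ y := by rintro rfl; exact hne rfl
      exact hQ ⟨r, by simp [hz.1.trans hzr, lt_of_le_of_ne hr hry, hpr]⟩
    · exact (hmin p hp (hpz.trans hz.2)).not_gt hpz

end Arcs

theorem Finset.exists_mem_card_filter_lt (E : Finset ℕ) {k : ℕ} (hk : k < E.card) :
    ∃ c ∈ E, ({v ∈ E | v < c} : Finset ℕ).card = k := by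
  induction E using Finset.induction_on_max with
  | empty => simp at hk
  | insert a E ha ih =>
    have haE : a ∉ E := fun h ↦ (ha a h).false
    rw [card_insert_of_notMem haE] at hk
    rcases (Nat.lt_succ_iff.1 hk).eq_or_lt with rfl | hk
    · refine ⟨a, mem_insert_self _ _, ?_⟩
      rw [filter_insert, if_neg (lt_irrefl a), filter_true_of_mem ha]
    · obtain ⟨c, hc, hcard⟩ := ih hk
      refine ⟨c, mem_insert_of_mem hc, ?_⟩
      rwa [filter_insert, if_neg (ha c hc).not_gt]

theorem Finset.eq_of_card_filter_lt_eq {E : Finset ℕ} {c c' : ℕ} (hc : c ∈ E) (hc' : c' ∈ E)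
    (h : ({v ∈ E | v < c} : Finset ℕ).card = ({v ∈ E | v < c'} : Finset ℕ).card) : c = c' := by
  have key : ∀ {a b : ℕ}, a ∈ E → a < b →
      ({v ∈ E | v < a} : Finset ℕ).card < ({v ∈ E | v < b} : Finset ℕ).card := by
    intro a b ha hab
    refine card_lt_card ⟨fun v hv ↦ ?_, fun hsub ↦ ?_⟩
    · simp only [mem_filter] at hv ⊢
      exact ⟨hv.1, hv.2.trans hab⟩
    · have := hsub (mem_filter.2 ⟨ha, hab⟩)
      simp at this
  rcases lt_trichotomy c c' with hlt | heq | hlt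
  · exact absurd h (key hc hlt).ne
  · exact heq
  · exact absurd h (key hc' hlt).ne'

/-- The points of `{0, …, N}` covered by no chord of `D`. -/
def exposed (D : Finset (ℕ × ℕ)) (N : ℕ) : Finset ℕ :=
  {v ∈ range (N + 1) | ∀ d ∈ D, ¬(d.1 < v ∧ v < d.2)}

theorem mem_exposed {D : Finset (ℕ × ℕ)} {N v : ℕ} :
    v ∈ exposed D N ↔ v ≤ N ∧ ∀ p q, (p, q) ∈ D → ¬(p < v ∧ v < q) := by
  simp [exposed]

/-- A non-crossing set of chords over `{0, …, N}`, possibly including `(0, N)`, such that the cell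
below each chord has at most `m + 2` vertices. -/
structure IsArcSystem (m N : ℕ) (D : Finset (ℕ × ℕ)) : Prop where
  bounds : ∀ p q, (p, q) ∈ D → p + 2 ≤ q ∧ q ≤ N
  nonCrossing : NonCrossing D
  card_le : ∀ p q, (p, q) ∈ D → (cellBelow D p q).card ≤ m + 2

open Classical in
/-- The arc systems whose exposed points form a path with `s` steps. -/
noncomputable def arcSystems (m N s : ℕ) : Finset (Finset (ℕ × ℕ)) :=
  {D ∈ (range (N + 1) ×ˢ range (N + 1)).powerset | IsArcSystem m N D ∧ (exposed D N).card = s + 1}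

theorem mem_arcSystems {m N s : ℕ} {D : Finset (ℕ × ℕ)} :
    D ∈ arcSystems m N s ↔ IsArcSystem m N D ∧ (exposed D N).card = s + 1 := by
  simp only [arcSystems, mem_filter, mem_powerset, and_iff_right_iff_imp, and_imp]
  rintro h - ⟨p, q⟩ hpq
  have := h.bounds p q hpq
  simp only [mem_product, mem_range]
  omega

theorem card_exposed_le (D : Finset (ℕ × ℕ)) (N : ℕ) : (exposed D N).card ≤ N + 1 :=
  (card_filter_le _ _).trans (card_range _).le

theorem arcSystems_eq_empty_of_lt {m N s : ℕ} (h : N < s) : arcSystems m N s = ∅ := by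
  refine eq_empty_of_forall_notMem fun D hD ↦ ?_
  have := card_exposed_le D N
  have := (mem_arcSystems.1 hD).2
  omega

theorem IsArcSystem.top_mem_exposed {m N : ℕ} {D : Finset (ℕ × ℕ)} (h : IsArcSystem m N D) :
    N ∈ exposed D N :=
  mem_exposed.2 ⟨le_rfl, fun p q hpq hv ↦ by have := h.bounds p q hpq; omega⟩

theorem arcSystems_succ_zero (m N : ℕ) : arcSystems m (N + 1) 0 = ∅ := by
  refine eq_empty_of_forall_notMem fun D hD ↦ ?_
  obtain ⟨h, hcard⟩ := mem_arcSystems.1 hD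
  have := card_le_one.1 hcard.le 0 (by simp [mem_exposed]) _ h.top_mem_exposed
  omega

theorem arcSystems_zero_zero (m : ℕ) : arcSystems m 0 0 = {∅} := by
  ext D
  rw [mem_arcSystems, mem_singleton]
  constructor
  · rintro ⟨h, -⟩
    refine eq_empty_of_forall_notMem ?_
    rintro ⟨p, q⟩ hpq
    have := h.bounds p q hpq
    omega
  · rintro rfl
    exact ⟨⟨by simp, by simp [NonCrossing], by simp⟩, by simp [exposed]⟩

/-- If the last step of the path is a side, it can be removed. -/
theorem filter_mem_exposed_arcSystems (m N s : ℕ) :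
    {D ∈ arcSystems m (N + 1) (s + 1) | N ∈ exposed D (N + 1)} = arcSystems m N s := by
  ext D
  simp only [mem_filter, mem_arcSystems]
  have hins : (∀ p q, (p, q) ∈ D → p + 2 ≤ q ∧ q ≤ N) →
      exposed D (N + 1) = insert (N + 1) (exposed D N) := by
    intro hb
    ext v
    simp only [mem_exposed, mem_insert]
    constructor
    · rintro ⟨hv, h⟩
      exact (Nat.lt_or_eq_of_le hv).symm.imp id fun hv ↦ ⟨by omega, h⟩
    · rintro (rfl | ⟨hv, h⟩)
      · exact ⟨le_rfl, fun p q hpq hv ↦ by have := hb p q hpq; omega⟩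
      · exact ⟨by omega, h⟩
  have hcard : (∀ p q, (p, q) ∈ D → p + 2 ≤ q ∧ q ≤ N) →
      (exposed D (N + 1)).card = (exposed D N).card + 1 := by
    intro hb
    rw [hins hb, card_insert_of_notMem]
    simp [mem_exposed]
  constructor
  · rintro ⟨⟨h, hc⟩, hN⟩
    have hb : ∀ p q, (p, q) ∈ D → p + 2 ≤ q ∧ q ≤ N := by
      intro p q hpq
      have h₁ := h.bounds p q hpq
      have h₂ := (mem_exposed.1 hN).2 p q hpq
      omega
    exact ⟨⟨hb, h.nonCrossing, h.card_le⟩, by have := hcard hb; omega⟩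
  · rintro ⟨h, hc⟩
    refine ⟨⟨⟨fun p q hpq ↦ ?_, h.nonCrossing, h.card_le⟩, by have := hcard h.bounds; omega⟩, ?_⟩
    · have := h.bounds p q hpq
      omega
    · exact mem_exposed.2 ⟨by omega, fun p q hpq hv ↦ by have := h.bounds p q hpq; omega⟩

section Insert

variable {D : Finset (ℕ × ℕ)} {N c : ℕ}

theorem cellBelow_insert_of_mem (hc : c ∈ exposed D N) (hn : (c, N) ∉ D) {p q : ℕ}
    (hpq : (p, q) ∈ D) (hq : q ≤ N) : cellBelow (insert (c, N) D) p q = cellBelow D p q := by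
  ext v
  rw [mem_cellBelow, mem_cellBelow]
  refine and_congr_right fun hv ↦ ⟨fun h a b hab ↦ h a b (mem_insert_of_mem hab), ?_⟩
  intro h a b hab hpa hbq hne
  rcases mem_insert.1 hab with heq | hab
  · obtain ⟨rfl, rfl⟩ := Prod.mk.inj heq
    have hbq' : b = q := le_antisymm hbq hq
    subst hbq'
    rintro ⟨hav, hvb⟩
    rcases hpa.eq_or_lt with rfl | hpa
    · exact hne rfl
    · exact (mem_exposed.1 hc).2 p b hpq ⟨hpa, hav.trans hvb⟩
  · exact h a b hab hpa hbq hne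

theorem cellBelow_insert_self (hb : ∀ p q, (p, q) ∈ D → q ≤ N) (hc : c ∈ exposed D N)
    (hn : (c, N) ∉ D) : cellBelow (insert (c, N) D) c N = {v ∈ exposed D N | c ≤ v} := by
  ext v
  simp only [mem_cellBelow, mem_filter, mem_exposed]
  constructor
  · rintro ⟨⟨hcv, hvN⟩, h⟩
    refine ⟨⟨hvN, fun p q hpq hv ↦ ?_⟩, hcv⟩
    have hne : (p, q) ≠ (c, N) := by rintro heq; exact hn (heq ▸ hpq)
    rcases le_or_gt c p with hcp | hpc
    · exact h p q (mem_insert_of_mem hpq) hcp (hb p q hpq) hne hv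
    · exact (mem_exposed.1 hc).2 p q hpq ⟨hpc, by omega⟩
  · rintro ⟨⟨hvN, h⟩, hcv⟩
    refine ⟨⟨hcv, hvN⟩, fun p q hpq hcp hqN hne ↦ h p q ?_⟩
    exact (mem_insert.1 hpq).resolve_left hne

theorem isArcSystem_insert_iff {m : ℕ} (hc : c ∈ exposed D N) (hcN : c + 2 ≤ N) (hn : (c, N) ∉ D) :
    IsArcSystem m N (insert (c, N) D) ↔
      IsArcSystem m N D ∧ ({v ∈ exposed D N | c ≤ v} : Finset ℕ).card ≤ m + 2 := by
  constructor
  · intro h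
    have hb : ∀ p q, (p, q) ∈ D → p + 2 ≤ q ∧ q ≤ N :=
      fun p q hpq ↦ h.bounds p q (mem_insert_of_mem hpq)
    refine ⟨⟨hb, fun d hd e he ↦ h.nonCrossing d (mem_insert_of_mem hd) e (mem_insert_of_mem he),
      fun p q hpq ↦ ?_⟩, ?_⟩
    · rw [← cellBelow_insert_of_mem hc hn hpq (hb p q hpq).2]
      exact h.card_le p q (mem_insert_of_mem hpq)
    · rw [← cellBelow_insert_self (fun p q hpq ↦ (hb p q hpq).2) hc hn]
      exact h.card_le c N (mem_insert_self _ _)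
  · rintro ⟨h, hcard⟩
    refine ⟨?_, ?_, ?_⟩
    · intro p q hpq
      rcases mem_insert.1 hpq with heq | hpq
      · obtain ⟨rfl, rfl⟩ := Prod.mk.inj heq
        exact ⟨hcN, le_rfl⟩
      · exact h.bounds p q hpq
    · rintro ⟨p, q⟩ hd ⟨p', q'⟩ he ⟨h₁, h₂, h₃⟩
      rcases mem_insert.1 hd with heq | hd'
      · obtain ⟨rfl, rfl⟩ := Prod.mk.inj heq
        rcases mem_insert.1 he with heq | he'
        · obtain ⟨rfl, rfl⟩ := Prod.mk.inj heq
          exact h₁.false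
        · exact (h.bounds p' q' he').2.not_gt h₃
      · rcases mem_insert.1 he with heq | he'
        · obtain ⟨rfl, rfl⟩ := Prod.mk.inj heq
          exact (mem_exposed.1 hc).2 p q hd' ⟨h₁, h₂⟩
        · exact h.nonCrossing _ hd' _ he' ⟨h₁, h₂, h₃⟩
    · intro p q hpq
      rcases mem_insert.1 hpq with heq | hpq
      · obtain ⟨rfl, rfl⟩ := Prod.mk.inj heq
        rwa [cellBelow_insert_self (fun p q hpq ↦ (h.bounds p q hpq).2) hc hn]
      · rw [cellBelow_insert_of_mem hc hn hpq (h.bounds p q hpq).2]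
        exact h.card_le p q hpq

theorem card_exposed_insert (hN : N ∈ exposed D N) (hc : c ∈ exposed D N) (hcN : c < N) :
    (exposed (insert (c, N) D) N).card = ({v ∈ exposed D N | v < c} : Finset ℕ).card + 2 := by
  have : exposed (insert (c, N) D) N = insert N (insert c {v ∈ exposed D N | v < c}) := by
    ext v
    simp only [mem_insert, mem_filter, mem_exposed] at hN hc ⊢
    constructor
    · rintro ⟨hv, h⟩
      have h₁ := h c N (Or.inl rfl)
      rcases lt_trichotomy v c with hvc | hvc | hvc
      · exact Or.inr (Or.inr ⟨⟨hv, fun p q hpq ↦ h p q (Or.inr hpq)⟩, hvc⟩)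
      · exact Or.inr (Or.inl hvc)
      · exact Or.inl (by omega)
    · rintro (rfl | rfl | ⟨⟨hv, h⟩, hvc⟩)
      · refine ⟨le_rfl, fun p q hpq ↦ ?_⟩
        rcases hpq with heq | hpq
        · obtain ⟨rfl, rfl⟩ := Prod.mk.inj heq
          simp
        · exact hN.2 p q hpq
      · refine ⟨hcN.le, fun p q hpq ↦ ?_⟩
        rcases hpq with heq | hpq
        · obtain ⟨rfl, rfl⟩ := Prod.mk.inj heq
          simp
        · exact hc.2 p q hpq
      · refine ⟨hv, fun p q hpq ↦ ?_⟩
        rcases hpq with heq | hpq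
        · obtain ⟨rfl, rfl⟩ := Prod.mk.inj heq
          omega
        · exact h p q hpq
  rw [this, card_insert_of_notMem, card_insert_of_notMem] <;> simp; omega

theorem card_exposed_eq_add (c : ℕ) :
    (exposed D N).card = ({v ∈ exposed D N | v < c} : Finset ℕ).card +
      ({v ∈ exposed D N | c ≤ v} : Finset ℕ).card := by
  rw [← card_filter_add_card_filter_not (fun v ↦ v < c)]
  simp only [not_lt]

end Insert

/-- In an arc system whose last step is not a side, the last step is a chord `(c, N + 1)`. -/
theorem IsArcSystem.exists_last_chord {m N : ℕ} {D : Finset (ℕ × ℕ)} (h : IsArcSystem m (N + 1) D)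
    (hN : N ∉ exposed D (N + 1)) : ∃ c, (c, N + 1) ∈ D ∧ c ∈ exposed D (N + 1) := by
  have hex : ∃ c, (c, N + 1) ∈ D := by
    by_contra! hno
    refine hN (mem_exposed.2 ⟨by omega, fun p q hpq hv ↦ ?_⟩)
    have := h.bounds p q hpq
    obtain rfl : q = N + 1 := by omega
    exact hno p hpq
  classical
  refine ⟨Nat.find hex, Nat.find_spec hex, mem_exposed.2 ⟨?_, fun p q hpq hv ↦ ?_⟩⟩
  · have := h.bounds _ _ (Nat.find_spec hex)
    omega
  · rcases (h.bounds p q hpq).2.eq_or_lt with rfl | hq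
    · exact Nat.find_min hex hv.1 hpq
    · exact h.nonCrossing _ hpq _ (Nat.find_spec hex) ⟨hv.1, hv.2, hq⟩

/-- If the last step of the path is a chord, it can be removed, which uncovers at least one and
at most `m` points. -/
theorem card_filter_notMem_exposed_arcSystems (m N s : ℕ) :
    ({D ∈ arcSystems m (N + 1) (s + 1) | N ∉ exposed D (N + 1)} : Finset _).card =
      ∑ j ∈ range m, (arcSystems m (N + 1) (s + 1 + (j + 1))).card := by
  classical
  have hdisj : Set.PairwiseDisjoint (range m : Set ℕ)
      fun j ↦ arcSystems m (N + 1) (s + 1 + (j + 1)) := by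
    refine fun i _ j _ hij ↦ disjoint_left.2 fun D hi hj ↦ hij ?_
    have := (mem_arcSystems.1 hi).2
    have := (mem_arcSystems.1 hj).2
    omega
  rw [← card_biUnion hdisj]
  have hmem : ∀ D, D ∈ (range m).biUnion (fun j ↦ arcSystems m (N + 1) (s + 1 + (j + 1))) ↔
      IsArcSystem m (N + 1) D ∧ s + 3 ≤ (exposed D (N + 1)).card ∧
        (exposed D (N + 1)).card ≤ s + m + 2 := by
    intro D
    simp only [mem_biUnion, mem_range, mem_arcSystems]
    constructor
    · rintro ⟨j, hj, h, hc⟩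
      exact ⟨h, by omega, by omega⟩
    · rintro ⟨h, h₁, h₂⟩
      exact ⟨(exposed D (N + 1)).card - (s + 3), by omega, h, by omega⟩
  have hsel : ∀ D : Finset (ℕ × ℕ), ∃ c, s < (exposed D (N + 1)).card →
      c ∈ exposed D (N + 1) ∧ ({v ∈ exposed D (N + 1) | v < c} : Finset ℕ).card = s := by
    intro D
    by_cases hs : s < (exposed D (N + 1)).card
    · obtain ⟨c, hc, hcs⟩ := exists_mem_card_filter_lt _ hs
      exact ⟨c, fun _ ↦ ⟨hc, hcs⟩⟩
    · exact ⟨0, fun h ↦ absurd h hs⟩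
  choose c hc using hsel
  have key : ∀ D, IsArcSystem m (N + 1) D → s + 3 ≤ (exposed D (N + 1)).card →
      c D ∈ exposed D (N + 1) ∧ ({v ∈ exposed D (N + 1) | v < c D} : Finset ℕ).card = s ∧
        ∃ v ∈ exposed D (N + 1), c D < v ∧ v < N + 1 := by
    intro D h hs
    obtain ⟨h₁, h₂⟩ := hc D (by omega)
    refine ⟨h₁, h₂, ?_⟩
    by_contra! hno
    have hsub : ({v ∈ exposed D (N + 1) | c D ≤ v} : Finset ℕ) ⊆ {c D, N + 1} := by
      intro v hv
      rw [mem_filter] at hv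
      have := (mem_exposed.1 hv.1).1
      have := hno v hv.1
      simp only [mem_insert, mem_singleton]
      omega
    have := (card_le_card hsub).trans card_le_two
    have := card_exposed_eq_add (D := D) (N := N + 1) (c D)
    omega
  have hnot : ∀ D, IsArcSystem m (N + 1) D → s + 3 ≤ (exposed D (N + 1)).card →
      (c D, N + 1) ∉ D := by
    intro D h hs hmemD
    obtain ⟨-, -, v, hv, hv'⟩ := key D h hs
    exact (mem_exposed.1 hv).2 _ _ hmemD hv'
  symm
  refine card_bij (fun D _ ↦ insert (c D, N + 1) D) ?_ ?_ ?_
  · intro D hD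
    obtain ⟨h, h₁, h₂⟩ := (hmem D).1 hD
    obtain ⟨hcE, hcs, v, hvE, hv⟩ := key D h h₁
    have hadd := card_exposed_eq_add (D := D) (N := N + 1) (c D)
    rw [mem_filter, mem_arcSystems, isArcSystem_insert_iff hcE (by omega) (hnot D h h₁),
      card_exposed_insert h.top_mem_exposed hcE (by omega)]
    refine ⟨⟨⟨h, by omega⟩, by omega⟩, fun hN ↦ ?_⟩
    exact (mem_exposed.1 hN).2 _ _ (mem_insert_self _ _) ⟨by omega, by omega⟩
  · intro D₁ hD₁ D₂ hD₂ heq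
    obtain ⟨h₁, hs₁, -⟩ := (hmem D₁).1 hD₁
    obtain ⟨h₂, hs₂, -⟩ := (hmem D₂).1 hD₂
    have hle : ∀ A B : Finset (ℕ × ℕ), IsArcSystem m (N + 1) B → s + 3 ≤ (exposed B (N + 1)).card →
        insert (c A, N + 1) A = insert (c B, N + 1) B → c B ≤ c A := by
      intro A B hB hsB hAB
      have hA : (c A, N + 1) ∈ insert (c B, N + 1) B := hAB ▸ mem_insert_self _ _
      rcases mem_insert.1 hA with heq | hA
      · exact (Prod.mk.inj heq).1.ge
      · obtain ⟨hcE, -, v, -, hv⟩ := key B hB hsB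
        by_contra! hlt
        exact (mem_exposed.1 hcE).2 _ _ hA ⟨hlt, by omega⟩
    have hcc : c D₁ = c D₂ := le_antisymm (hle _ _ h₁ hs₁ heq.symm) (hle _ _ h₂ hs₂ heq)
    rw [← erase_insert (hnot D₁ h₁ hs₁), show insert _ D₁ = insert _ D₂ from heq, hcc,
      erase_insert (hnot D₂ h₂ hs₂)]
  · intro D hD
    obtain ⟨hD, hN⟩ := mem_filter.1 hD
    obtain ⟨h, hcard⟩ := mem_arcSystems.1 hD
    obtain ⟨p, hpD, hpE⟩ := h.exists_last_chord hN
    have hins : insert (p, N + 1) (D.erase (p, N + 1)) = D := insert_erase hpD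
    set D' := D.erase (p, N + 1) with hD'
    have hn : (p, N + 1) ∉ D' := notMem_erase _ _
    have hpE' : p ∈ exposed D' (N + 1) :=
      mem_exposed.2 ⟨(mem_exposed.1 hpE).1,
        fun a b hab ↦ (mem_exposed.1 hpE).2 a b (mem_of_mem_erase hab)⟩
    have hpN := (h.bounds _ _ hpD).1
    obtain ⟨h', hm⟩ := (isArcSystem_insert_iff hpE' hpN hn).1 (hins.symm ▸ h)
    have hcard' := card_exposed_insert h'.top_mem_exposed hpE' (by omega)
    rw [hins] at hcard'
    have hadd := card_exposed_eq_add (D := D') (N := N + 1) p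
    have h3 : 3 ≤ ({v ∈ exposed D' (N + 1) | p ≤ v} : Finset ℕ).card := by
      obtain ⟨v, hv, hpv, hvN⟩ := exists_mem_cellBelow_between h.nonCrossing
        (x := p) (y := N + 1) ⟨p + 1, by simp; omega⟩
      rw [← hins, cellBelow_insert_self (fun a b hab ↦ (h'.bounds a b hab).2) hpE' hn] at hv
      have hsub : ({p, v, N + 1} : Finset ℕ) ⊆ {v ∈ exposed D' (N + 1) | p ≤ v} := by
        intro w hw
        simp only [mem_insert, mem_singleton] at hw
        rcases hw with rfl | rfl | rfl
        · exact mem_filter.2 ⟨hpE', le_rfl⟩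
        · exact hv
        · exact mem_filter.2 ⟨h'.top_mem_exposed, by omega⟩
      rw [← card_eq_three.2 ⟨p, v, N + 1, by omega, by omega, by omega, rfl⟩]
      exact card_le_card hsub
    have hs3 : s + 3 ≤ (exposed D' (N + 1)).card := by omega
    refine ⟨D', (hmem D').2 ⟨h', hs3, by omega⟩, ?_⟩
    obtain ⟨hcE, hcs, -⟩ := key D' h' hs3
    rw [eq_of_card_filter_lt_eq hcE hpE' (by omega), hins]

/-- The recurrence for arc systems, by the last step of the path. -/
theorem card_arcSystems_succ (m N s : ℕ) :
    (arcSystems m (N + 1) (s + 1)).card = (arcSystems m N s).card +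
      ∑ j ∈ range m, (arcSystems m (N + 1) (s + 1 + (j + 1))).card := by
  rw [← card_filter_notMem_exposed_arcSystems, ← filter_mem_exposed_arcSystems m N s,
    card_filter_add_card_filter_not]

section Polygon

variable {n : ℕ}

/-- The cells of a dissection are the sets below its diagonals and below the edge joining the first
to the last vertex. -/
theorem isCell_iff {D : Finset (Fin (n + 2) × Fin (n + 2))} (hD : IsDissection D)
    {C : Finset (Fin (n + 2))} :
    IsCell D C ↔ ∃ d, (d ∈ D ∨ d = (0, Fin.last (n + 1))) ∧ C = cellBelow D d.1 d.2 := by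
  have hlt : ∀ d, (d ∈ D ∨ d = (0, Fin.last (n + 1))) → d.1 < d.2 := by
    rintro d (hd | rfl)
    · exact (hD.1 d hd).1
    · exact Fin.last_pos
  have hunsep : ∀ d, (d ∈ D ∨ d = (0, Fin.last (n + 1))) → ∀ u ∈ cellBelow D d.1 d.2,
      ∀ v ∈ cellBelow D d.1 d.2, ∀ e ∈ D, e.1 < u → u < e.2 → ¬(v < e.1 ∨ e.2 < v) := by
    rintro ⟨x, y⟩ hd u hu v hv ⟨p, q⟩ he hpu huq hv'
    rw [mem_cellBelow] at hu hv
    dsimp only at *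
    have h₁ : ¬(x < p ∧ p < y ∧ y < q) := by
      rcases hd with hd | hd
      · exact hD.2 _ hd _ he
      · have : y = Fin.last (n + 1) := (Prod.mk.inj hd).2
        exact fun h ↦ (this ▸ Fin.le_last q).not_gt h.2.2
    have h₂ : ¬(p < x ∧ x < q ∧ q < y) := by
      rcases hd with hd | hd
      · exact hD.2 _ he _ hd
      · have : x = 0 := (Prod.mk.inj hd).1
        exact fun h ↦ (this ▸ Fin.zero_le p).not_gt h.1
    have h₃ := hu.2 p q he
    have h₄ : (p, q) = (x, y) ↔ p = x ∧ q = y := Prod.mk.injEq .. ▸ Iff.rfl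
    grind
  have hsub : ∀ C : Finset (Fin (n + 2)), (∀ x ∈ C, ∀ y ∈ C, ∀ d ∈ D, ¬SeparatedBy d x y) →
      ∃ d, (d ∈ D ∨ d = (0, Fin.last (n + 1))) ∧ C ⊆ cellBelow D d.1 d.2 := by
    intro C hC
    obtain ⟨⟨x, y⟩, hd, hmin⟩ := exists_min_image
      {d ∈ insert (0, Fin.last (n + 1)) D | ∀ v ∈ C, d.1 ≤ v ∧ v ≤ d.2}
      (fun d ↦ d.2.val - d.1.val)
      ⟨(0, Fin.last (n + 1)), by simp [Fin.le_last]⟩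
    simp only [mem_filter, mem_insert, and_imp] at hd hmin
    refine ⟨(x, y), hd.1.symm, fun v hv ↦ mem_cellBelow.2 ⟨hd.2 v hv, ?_⟩⟩
    rintro p q hpq hxp hqy hne ⟨hpv, hvq⟩
    have hout : ∃ w ∈ C, w < p ∨ q < w := by
      by_contra! hno
      have := hmin (p, q) (Or.inr hpq) hno
      have := hlt (p, q) (Or.inl hpq)
      have h₄ : (p, q) = (x, y) ↔ p = x ∧ q = y := Prod.mk.injEq .. ▸ Iff.rfl
      simp only [Fin.lt_def, Fin.le_def, ne_eq, h₄, Fin.ext_iff] at *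
      omega
    obtain ⟨w, hw, hw'⟩ := hout
    refine hC v hv w hw (p, q) hpq ?_
    simp only [SeparatedBy, Fin.lt_def, ne_eq, Fin.ext_iff] at *
    omega
  constructor
  · rintro ⟨hC, hmax⟩
    obtain ⟨d, hd, hCd⟩ := hsub C hC
    refine ⟨d, hd, (hmax _ hCd fun u hu v hv e he hsep ↦ ?_).symm⟩
    have h₁ := hunsep d hd u hu v hv e he
    have h₂ := hunsep d hd v hv u hu e he
    simp only [SeparatedBy, Fin.lt_def, ne_eq, Fin.ext_iff] at *
    omega
  · rintro ⟨⟨x, y⟩, hd, rfl⟩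
    refine ⟨fun u hu v hv e he hsep ↦ ?_, fun C' hsub' hC' ↦ hsub'.antisymm' fun v hv ↦ ?_⟩
    · have h₁ := hunsep _ hd u hu v hv e he
      have h₂ := hunsep _ hd v hv u hu e he
      simp only [SeparatedBy, Fin.lt_def, ne_eq, Fin.ext_iff] at *
      omega
    · have hxy := (hlt _ hd).le
      have hx := hsub' (left_mem_cellBelow hxy)
      have hy := hsub' (right_mem_cellBelow hxy)
      have hin : x ≤ v ∧ v ≤ y := by
        rcases hd with hd | hd
        · by_contra hout
          have hdiag : x.val + 1 < y.val := (hD.1 _ hd).2.1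
          obtain ⟨z, hz, hxz, hzy⟩ := exists_mem_cellBelow_between hD.2 (x := x) (y := y)
            ⟨⟨x + 1, by omega⟩, by simp only [mem_Ioo, Fin.lt_def]; omega⟩
          refine hC' v hv z (hsub' hz) _ hd ?_
          simp only [SeparatedBy, Fin.lt_def, Fin.le_def, ne_eq, Fin.ext_iff] at *
          omega
        · obtain ⟨rfl, rfl⟩ := Prod.mk.inj hd
          exact ⟨Fin.zero_le v, Fin.le_last v⟩
      refine mem_cellBelow.2 ⟨hin, ?_⟩
      rintro p q hpq hxp hqy hne ⟨hpv, hvq⟩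
      have h₁ := hC' v hv x hx _ hpq
      have h₂ := hC' v hv y hy _ hpq
      have h₄ : (p, q) = (x, y) ↔ p = x ∧ q = y := Prod.mk.injEq .. ▸ Iff.rfl
      simp only [SeparatedBy, Fin.lt_def, Fin.le_def, ne_eq, h₄, Fin.ext_iff] at *
      omega

theorem map_cellBelow {N : ℕ} (D : Finset (Fin N × Fin N)) (x y : Fin N) :
    (cellBelow D x y).map Fin.valEmbedding =
      cellBelow (D.map (Fin.valEmbedding.prodMap Fin.valEmbedding)) x.val y.val := by
  ext v
  rw [mem_map, mem_cellBelow]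
  constructor
  · rintro ⟨v, hv, rfl⟩
    rw [mem_cellBelow] at hv
    refine ⟨hv.1, fun p q hpq hxp hqy hne ↦ ?_⟩
    obtain ⟨⟨p, q⟩, hpq', heq⟩ := mem_map.1 hpq
    obtain ⟨rfl, rfl⟩ := Prod.mk.inj heq
    exact hv.2 p q hpq' hxp hqy fun h ↦ hne (by obtain ⟨rfl, rfl⟩ := Prod.mk.inj h; rfl)
  · rintro ⟨hv, h⟩
    refine ⟨⟨v, hv.2.trans_lt y.2⟩, mem_cellBelow.2 ⟨hv, fun p q hpq hxp hqy hne ↦ ?_⟩, rfl⟩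
    refine h p q (mem_map.2 ⟨(p, q), hpq, rfl⟩) hxp hqy fun heq ↦ hne ?_
    obtain ⟨hp, hq⟩ := Prod.mk.inj heq
    rw [Fin.ext hp, Fin.ext hq]

theorem exposed_eq_cellBelow {D : Finset (ℕ × ℕ)} {N : ℕ} (hb : ∀ p q, (p, q) ∈ D → q ≤ N)
    (h : (0, N) ∉ D) : exposed D N = cellBelow D 0 N := by
  ext v
  rw [mem_exposed, mem_cellBelow]
  refine and_congr (by simp) ⟨fun hv p q hpq _ _ _ ↦ hv p q hpq, fun hv p q hpq ↦ ?_⟩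
  exact hv p q hpq (Nat.zero_le p) (hb p q hpq) fun heq ↦ h (heq ▸ hpq)

theorem three_le_card_cellBelow {α : Type*} [LinearOrder α] [LocallyFiniteOrder α]
    {D : Finset (α × α)} (hD : NonCrossing D) {x y : α} (hxy : (Ioo x y).Nonempty) :
    3 ≤ (cellBelow D x y).card := by
  obtain ⟨v, hv, hxv, hvy⟩ := exists_mem_cellBelow_between hD hxy
  have hle := (hxv.trans hvy).le
  refine (card_eq_three.2 ⟨x, v, y, hxv.ne, (hxv.trans hvy).ne, hvy.ne, rfl⟩).symm.le.trans
    (card_le_card fun w hw ↦ ?_)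
  simp only [mem_insert, mem_singleton] at hw
  rcases hw with rfl | rfl | rfl
  · exact left_mem_cellBelow hle
  · exact hv
  · exact right_mem_cellBelow hle

theorem bounded_dissection_iff {m : ℕ} (D : Finset (Fin (n + 2) × Fin (n + 2))) :
    (IsDissection D ∧ ∀ C : Finset (Fin (n + 2)), IsCell D C → 3 ≤ C.card ∧ C.card ≤ m + 2) ↔
      IsArcSystem m (n + 1) (D.map (Fin.valEmbedding.prodMap Fin.valEmbedding)) ∧
      3 ≤ (exposed (D.map (Fin.valEmbedding.prodMap Fin.valEmbedding)) (n + 1)).card ∧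
      (exposed (D.map (Fin.valEmbedding.prodMap Fin.valEmbedding)) (n + 1)).card ≤ m + 2 := by
  set E := D.map (Fin.valEmbedding.prodMap Fin.valEmbedding) with hE
  have hmem : ∀ p q : Fin (n + 2), (p, q) ∈ D ↔ (p.val, q.val) ∈ E := fun p q ↦
    (mem_map' (Fin.valEmbedding.prodMap Fin.valEmbedding) (a := (p, q)) (s := D)).symm
  have hmem' : ∀ p q : ℕ, (p, q) ∈ E → ∃ p' q' : Fin (n + 2), p'.val = p ∧ q'.val = q ∧
      (p', q') ∈ D := by
    intro p q hpq
    obtain ⟨⟨p', q'⟩, h, heq⟩ := mem_map.1 hpq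
    obtain ⟨rfl, rfl⟩ := Prod.mk.inj heq
    exact ⟨p', q', rfl, rfl, h⟩
  have hcard : ∀ x y : Fin (n + 2), (cellBelow D x y).card = (cellBelow E x.val y.val).card :=
    fun x y ↦ by rw [hE, ← map_cellBelow, card_map]
  have hbE : ∀ p q, (p, q) ∈ E → q ≤ n + 1 := by
    intro p q hpq
    obtain ⟨p, q, rfl, rfl, -⟩ := hmem' p q hpq
    omega
  have hroot : (0, n + 1) ∉ E →
      (cellBelow D 0 (Fin.last (n + 1))).card = (exposed E (n + 1)).card := by
    intro h
    rw [hcard, exposed_eq_cellBelow hbE h]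
    rfl
  constructor
  · rintro ⟨hD, hC⟩
    have hn : (0, n + 1) ∉ E := by
      intro h
      obtain ⟨p, q, hp, hq, hpq⟩ := hmem' _ _ h
      exact (hD.1 _ hpq).2.2 ⟨hp, hq⟩
    refine ⟨⟨fun p q hpq ↦ ⟨?_, hbE p q hpq⟩, ?_, fun p q hpq ↦ ?_⟩, ?_⟩
    · obtain ⟨p, q, rfl, rfl, hd⟩ := hmem' p q hpq
      exact (hD.1 _ hd).2.1
    · rintro ⟨p, q⟩ hpq ⟨p', q'⟩ hpq'
      obtain ⟨p, q, rfl, rfl, hd⟩ := hmem' p q hpq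
      obtain ⟨p', q', rfl, rfl, hd'⟩ := hmem' p' q' hpq'
      exact hD.2 _ hd _ hd'
    · obtain ⟨p, q, rfl, rfl, hd⟩ := hmem' p q hpq
      rw [← hcard]
      exact (hC _ ((isCell_iff hD).2 ⟨(p, q), Or.inl hd, rfl⟩)).2
    · rw [← hroot hn]
      exact hC _ ((isCell_iff hD).2 ⟨(0, Fin.last (n + 1)), Or.inr rfl, rfl⟩)
  · rintro ⟨h, h₃, hm⟩
    have hn : (0, n + 1) ∉ E := by
      intro hr
      have : exposed E (n + 1) ⊆ {0, n + 1} := by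
        intro v hv
        have h₁ := (mem_exposed.1 hv).1
        have h₂ := (mem_exposed.1 hv).2 _ _ hr
        simp only [mem_insert, mem_singleton]
        omega
      have := (card_le_card this).trans card_le_two
      omega
    have hD : IsDissection D := by
      refine ⟨?_, ?_⟩
      · rintro ⟨p, q⟩ hpq
        have hpq' := (hmem p q).1 hpq
        have := h.bounds _ _ hpq'
        refine ⟨by simp only [Fin.lt_def]; omega, by dsimp only; omega, ?_⟩
        rintro ⟨hp, hq⟩
        dsimp only at hp hq
        rw [hp, hq] at hpq'
        exact hn hpq'
      · rintro ⟨p, q⟩ hpq ⟨p', q'⟩ hpq'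
        exact h.nonCrossing _ ((hmem _ _).1 hpq) _ ((hmem _ _).1 hpq')
    refine ⟨hD, fun C hC ↦ ?_⟩
    obtain ⟨⟨p, q⟩, hd, rfl⟩ := (isCell_iff hD).1 hC
    rcases hd with hd | hd
    · have hpq := (hmem p q).1 hd
      have := h.bounds _ _ hpq
      rw [hcard]
      exact ⟨three_le_card_cellBelow h.nonCrossing ⟨p + 1, by simp; omega⟩, h.card_le _ _ hpq⟩
    · rw [hd, hroot hn]
      exact ⟨h₃, hm⟩

theorem card_bounded_dissections (n m : ℕ) :
    Nat.card {D : Finset (Fin (n + 2) × Fin (n + 2)) // IsDissection D ∧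
        ∀ C : Finset (Fin (n + 2)), IsCell D C → 3 ≤ C.card ∧ C.card ≤ m + 2} =
      ∑ j ∈ range m, (arcSystems m (n + 1) (1 + (j + 1))).card := by
  classical
  have hdisj : Set.PairwiseDisjoint (range m : Set ℕ)
      fun j ↦ arcSystems m (n + 1) (1 + (j + 1)) := by
    refine fun i _ j _ hij ↦ disjoint_left.2 fun D hi hj ↦ hij ?_
    have := (mem_arcSystems.1 hi).2
    have := (mem_arcSystems.1 hj).2
    omega
  rw [← card_biUnion hdisj, Nat.card_eq_fintype_card, Fintype.card_subtype]
  have hmem : ∀ D, D ∈ (range m).biUnion (fun j ↦ arcSystems m (n + 1) (1 + (j + 1))) ↔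
      IsArcSystem m (n + 1) D ∧ 3 ≤ (exposed D (n + 1)).card ∧
        (exposed D (n + 1)).card ≤ m + 2 := by
    intro D
    simp only [mem_biUnion, mem_range, mem_arcSystems]
    constructor
    · rintro ⟨j, hj, h, hc⟩
      exact ⟨h, by omega, by omega⟩
    · rintro ⟨h, h₁, h₂⟩
      exact ⟨(exposed D (n + 1)).card - 3, by omega, h, by omega⟩
  refine card_bij (fun D _ ↦ D.map (Fin.valEmbedding.prodMap Fin.valEmbedding)) ?_ ?_ ?_
  · intro D hD
    exact (hmem _).2 ((bounded_dissection_iff D).1 (mem_filter.1 hD).2)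
  · intro D _ D' _ h
    exact map_injective _ h
  · intro E hE
    have hE' := (hmem E).1 hE
    have : E ⊆ univ.map (Fin.valEmbedding.prodMap Fin.valEmbedding :
        Fin (n + 2) × Fin (n + 2) ↪ ℕ × ℕ) := by
      rintro ⟨p, q⟩ hpq
      have := hE'.1.bounds p q hpq
      exact mem_map.2 ⟨(⟨p, by omega⟩, ⟨q, by omega⟩), mem_univ _, rfl⟩
    obtain ⟨D, -, rfl⟩ := subset_map_iff.1 this
    exact ⟨D, mem_filter.2 ⟨mem_univ _, (bounded_dissection_iff D).2 hE'⟩, rfl⟩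

end Polygon

section Series

open PowerSeries

/-- The generating function `X + X ^ 2 + ⋯ + X ^ m`. -/
noncomputable def stepSeries (m : ℕ) : ℚ⟦X⟧ :=
  ∑ j ∈ range m, X ^ (j + 1)

theorem stepSeries_eq_X_mul (m : ℕ) : stepSeries m = X * ∑ j ∈ range m, X ^ j := by
  simp only [stepSeries, mul_sum, pow_succ']

theorem constantCoeff_stepSeries (m : ℕ) : constantCoeff (stepSeries m) = 0 := by
  simp [stepSeries_eq_X_mul]

theorem inv_one_sub_stepSeries_mul (m : ℕ) : (1 - stepSeries m)⁻¹ * (1 - stepSeries m) = 1 :=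
  PowerSeries.inv_mul_cancel _ (by simp [constantCoeff_stepSeries])

theorem X_mul_derivative_stepSeries (m : ℕ) :
    X * d⁄dX ℚ (stepSeries m) = ∑ j ∈ range m, ((j + 1 : ℕ) : ℚ⟦X⟧) * X ^ (j + 1) := by
  rw [stepSeries, map_sum, mul_sum]
  refine sum_congr rfl fun j _ ↦ ?_
  rw [derivative_pow, derivative_X, Nat.add_sub_cancel]
  ring

theorem natCast_mul_X_mul_derivative_stepSeries_mul (m k : ℕ) :
    (k : ℚ⟦X⟧) * (X * d⁄dX ℚ (stepSeries m)) * (1 - stepSeries m)⁻¹ ^ (k + 1) =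
      X * d⁄dX ℚ ((1 - stepSeries m)⁻¹ ^ k) := by
  rcases k with - | k
  · simp
  · rw [derivative_pow, derivative_inv', map_sub, Nat.add_sub_cancel]
    simp
    ring

theorem coeff_X_mul_derivative (f : ℚ⟦X⟧) (M : ℕ) : coeff M (X * d⁄dX ℚ f) = M * coeff M f := by
  rcases M with - | M
  · simp
  · rw [coeff_succ_X_mul, coeff_derivative]
    push_cast
    ring

theorem coeff_inv_one_sub_stepSeries_pow_succ (m s M : ℕ) :
    (s + 1 : ℚ) * (s + M) * coeff M ((1 - stepSeries m)⁻¹ ^ (s + M + 1)) =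
      s * (s + M + 1) * coeff M ((1 - stepSeries m)⁻¹ ^ (s + M)) +
        (s + M) * ∑ j ∈ range m, if j + 1 ≤ M then
          (s + 1 + (j + 1) : ℚ) * coeff (M - (j + 1)) ((1 - stepSeries m)⁻¹ ^ (s + M + 1))
          else 0 := by
  set φ := (1 - stepSeries m)⁻¹ with hφ
  have hsum : (∑ j ∈ range m, if j + 1 ≤ M then
      (s + 1 + (j + 1) : ℚ) * coeff (M - (j + 1)) (φ ^ (s + M + 1)) else 0) =
      (s + 1) * coeff M (stepSeries m * φ ^ (s + M + 1)) +
        coeff M (X * d⁄dX ℚ (stepSeries m) * φ ^ (s + M + 1)) := by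
    rw [X_mul_derivative_stepSeries, stepSeries, sum_mul, sum_mul, map_sum, map_sum, mul_sum,
      ← sum_add_distrib]
    refine sum_congr rfl fun j _ ↦ ?_
    rw [mul_assoc, ← nsmul_eq_mul, map_nsmul, coeff_X_pow_mul', nsmul_eq_mul]
    split_ifs <;> push_cast <;> ring
  have hgeom : coeff M (stepSeries m * φ ^ (s + M + 1)) =
      coeff M (φ ^ (s + M + 1)) - coeff M (φ ^ (s + M)) := by
    rw [← map_sub]
    congr 1
    linear_combination -φ ^ (s + M) * inv_one_sub_stepSeries_mul m
  have hder : (s + M : ℚ) * coeff M (X * d⁄dX ℚ (stepSeries m) * φ ^ (s + M + 1)) =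
      M * coeff M (φ ^ (s + M)) := by
    rw [← coeff_X_mul_derivative, hφ, ← natCast_mul_X_mul_derivative_stepSeries_mul,
      mul_assoc (Nat.cast _), ← nsmul_eq_mul, map_nsmul, nsmul_eq_mul]
    push_cast
    rfl
  rw [hsum, hgeom]
  linear_combination (-1 : ℚ) * hder

/-- The number of arc systems, in the form given by Lagrange inversion. -/
theorem succ_mul_card_arcSystems (m N s : ℕ) :
    (N + 1 : ℚ) * (arcSystems m (N + 1) s).card =
      if s ≤ N + 1 then s * coeff (N + 1 - s) ((1 - stepSeries m)⁻¹ ^ (N + 1)) else 0 := by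
  induction N generalizing s with
  | zero =>
    rcases s with - | - | s
    · simp [arcSystems_succ_zero]
    · rw [card_arcSystems_succ, arcSystems_zero_zero, sum_eq_zero fun j _ ↦ by
        rw [arcSystems_eq_empty_of_lt (by omega), card_empty]]
      simp [constantCoeff_stepSeries]
    · rw [arcSystems_eq_empty_of_lt (by omega), if_neg (by omega)]
      simp
  | succ N ihN =>
    induction hd : N + 2 - s using Nat.strong_induction_on generalizing s with
    | _ d ih =>
      rcases s with - | s
      · simp [arcSystems_succ_zero]
      by_cases hs : s + 1 ≤ N + 2
      swap
      · rw [arcSystems_eq_empty_of_lt (by omega), if_neg hs]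
        simp
      obtain ⟨M, hM⟩ := Nat.exists_eq_add_of_le (show s ≤ N + 1 by omega)
      have hMQ : (N : ℚ) + 1 = s + M := by exact_mod_cast hM
      have hrec := coeff_inv_one_sub_stepSeries_pow_succ m s M
      rw [← hM] at hrec
      have hterm : ∀ j ∈ range m, ((N + 1 : ℕ) + 1 : ℚ) *
          (arcSystems m (N + 1 + 1) (s + 1 + (j + 1))).card = if j + 1 ≤ M then
          (s + 1 + (j + 1) : ℚ) * coeff (M - (j + 1)) ((1 - stepSeries m)⁻¹ ^ (N + 1 + 1))
          else 0 := by
        intro j _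
        by_cases hj : j + 1 ≤ M
        · rw [ih _ (by omega) _ rfl, if_pos (by omega), if_pos hj,
            show N + 1 + 1 - (s + 1 + (j + 1)) = M - (j + 1) by omega]
          push_cast
          ring
        · rw [arcSystems_eq_empty_of_lt (by omega), if_neg hj]
          simp
      rw [← sum_congr rfl hterm, ← mul_sum] at hrec
      have hN := ihN s
      rw [if_pos (by omega), show N + 1 - s = M by omega] at hN
      rw [if_pos hs, show d = M by omega, card_arcSystems_succ]
      have hne : (s + M : ℚ) ≠ 0 := by rw [← hMQ]; positivity
      apply mul_left_cancel₀ hne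
      push_cast at hrec hN ⊢
      rw [← hMQ] at hrec ⊢
      linear_combination (N + 2 : ℚ) * hN - hrec

theorem coeff_stepSeries_pow_of_lt {m n k : ℕ} (h : n < k) : coeff n (stepSeries m ^ k) = 0 := by
  rw [stepSeries_eq_X_mul, mul_pow, coeff_X_pow_mul', if_neg h.not_ge]

theorem coeff_inv_one_sub_stepSeries_pow (m n : ℕ) :
    coeff n ((1 - stepSeries m)⁻¹ ^ (n + 1)) =
      ∑ k ∈ range (n + 1), ((n + k).choose n : ℚ) * coeff n (stepSeries m ^ k) := by
  have hsub : HasSubst (stepSeries m) := .of_constantCoeff_zero' (constantCoeff_stepSeries m)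
  have hsubst : (PowerSeries.mk fun k ↦ ((n + k).choose n : ℚ)).subst (stepSeries m) =
      (1 - stepSeries m)⁻¹ ^ (n + 1) := by
    have h := congrArg (substAlgHom hsub) (mk_add_choose_mul_one_sub_pow_eq_one ℚ n)
    rw [map_mul, map_pow, map_sub, map_one, coe_substAlgHom, subst_X hsub] at h
    calc _ = _ * ((1 - stepSeries m)⁻¹ * (1 - stepSeries m)) ^ (n + 1) := by
          rw [inv_one_sub_stepSeries_mul, one_pow, mul_one]
      _ = _ := by
          rw [mul_pow, mul_left_comm, h, mul_one]
  rw [← hsubst, coeff_subst' hsub, finsum_eq_sum_of_support_subset (s := range (n + 1))]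
  · simp
  · intro k hk
    rw [Function.mem_support] at hk
    rw [coe_range, Set.mem_Iio]
    by_contra! hlt
    exact hk (by rw [coeff_stepSeries_pow_of_lt (by omega), smul_zero])

theorem coeff_stepSeries_pow_succ (m n l : ℕ) :
    coeff n (stepSeries m ^ (l + 1)) = ∑ i ∈ range (l + 2),
      (-1) ^ i * ibin ((n : ℤ) - 1 - m * i) l * ((l + 1).choose i : ℚ) := by
  have hgeom : (∑ j ∈ range m, (X : ℚ⟦X⟧) ^ j) ^ (l + 1) =
      (1 - X ^ m) ^ (l + 1) * PowerSeries.mk fun k ↦ ((l + k).choose l : ℚ) := by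
    rw [← geom_sum_mul_neg, mul_pow, mul_assoc, mul_comm ((1 - X) ^ (l + 1)),
      mk_add_choose_mul_one_sub_pow_eq_one, mul_one]
  have hexp : stepSeries m ^ (l + 1) = ∑ i ∈ range (l + 2),
      C ((-1) ^ i * ((l + 1).choose i : ℚ)) *
        (X ^ (l + 1 + m * i) * PowerSeries.mk fun k ↦ ((l + k).choose l : ℚ)) := by
    rw [stepSeries_eq_X_mul, mul_pow, hgeom, sub_eq_add_neg, add_comm (1 : ℚ⟦X⟧), add_pow, sum_mul, mul_sum]
    refine sum_congr rfl fun i _ ↦ ?_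
    rw [one_pow, neg_pow, ← pow_mul, pow_add]
    simp only [map_mul, map_pow, map_neg, map_one, map_natCast]
    ring
  rw [hexp, map_sum]
  refine sum_congr rfl fun i _ ↦ ?_
  rw [coeff_C_mul, coeff_X_pow_mul', coeff_mk, mul_right_comm]
  congr 1
  rw [mul_comm, mul_comm ((-1 : ℚ) ^ i)]
  congr 1
  generalize hk : m * i = k
  rw [show (m : ℤ) * i = k by exact_mod_cast hk, ibin]
  by_cases h : l + 1 + k ≤ n
  · rw [if_pos h, if_pos (by omega), show ((n : ℤ) - 1 - k).toNat = l + (n - (l + 1 + k)) by omega]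
  · rw [if_neg h]
    split_ifs
    · rw [Nat.choose_eq_zero_of_lt (by omega), Nat.cast_zero]
    · rfl

end Series

/-- the number of dissections of a convex `(n+2)`-gon by
non-crossing diagonals into cells with between `3` and `m+2` vertices. -/
theorem dissection_bounded_cells_card (n m : ℕ) :
    (Nat.card {D : Finset (Fin (n + 2) × Fin (n + 2)) //
        IsDissection D ∧
        ∀ C : Finset (Fin (n + 2)), IsCell D C → 3 ≤ C.card ∧ C.card ≤ m + 2} : ℚ) =
      ∑ l ∈ Finset.range n, (1 / ((l : ℚ) + 1)) * ((n + l + 1).choose l : ℚ) *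
        ∑ i ∈ Finset.range (l + 2),
          (-1) ^ i * ibin ((n : ℤ) - 1 - m * i) l * ((l + 1).choose i : ℚ) := by
  rw [card_bounded_dissections]
  rcases n with - | n
  · rw [range_zero, sum_empty, Nat.cast_eq_zero]
    exact sum_eq_zero fun j _ ↦ by rw [arcSystems_eq_empty_of_lt (by omega), card_empty]
  have hcard := card_arcSystems_succ m (n + 1) 0
  rw [arcSystems_succ_zero, card_empty, zero_add, zero_add] at hcard
  have hlag := succ_mul_card_arcSystems m (n + 1) 1
  rw [if_pos (by omega), Nat.add_sub_cancel, coeff_inv_one_sub_stepSeries_pow,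
    sum_range_succ', pow_zero, PowerSeries.coeff_one, if_neg (Nat.succ_ne_zero n), mul_zero,
    add_zero, Nat.cast_one, one_mul] at hlag
  rw [← hcard]
  have hne : ((n + 1 : ℕ) + 1 : ℚ) ≠ 0 := by positivity
  apply mul_left_cancel₀ hne
  rw [hlag, mul_sum]
  refine sum_congr rfl fun l _ ↦ ?_
  rw [coeff_stepSeries_pow_succ, ← mul_assoc]
  congr 1
  have hchoose := Nat.choose_succ_right_eq (n + 1 + (l + 1)) (n + 1)
  rw [Nat.add_sub_cancel_left, ← Nat.choose_symm_of_eq_add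
    (show n + 1 + (l + 1) = l + (n + 1 + 1) by omega)] at hchoose
  have hchooseQ := congrArg (Nat.cast : ℕ → ℚ) hchoose
  push_cast at hchooseQ ⊢
  field_simp
  linear_combination -hchooseQ
end

section
/- The number of Dyck paths of length 2n with each k-ascent coloured by an arbitrary concatenation of pyramids of total length 2k equals the number of little Schroeder paths of length 2n (i.e., the n-th little Schroeder number). -/
open Finset PowerSeries

/-- The pyramid `U^k D^k`. -/
def pyramid (k : ℕ) : List Bool :=
  List.replicate k true ++ List.replicate k false

/-- A path that is a concatenation of pyramids `U^k D^k`. -/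
def IsPyramidConcat (p : List Bool) : Prop :=
  ∃ ks : List ℕ, (∀ k ∈ ks, 1 ≤ k) ∧ p = (ks.map pyramid).flatten

/-- A little Schröder path of length `2n`: steps `U=(1,1)`, `D=(1,-1)`,
`L=(2,0)`, from `(0,0)` to `(2n,0)`, never below the x-axis, with no `L`-step
on the x-axis. -/
def IsLittleSchroederPath (n : ℕ) (p : List (ℤ × ℤ)) : Prop :=
  (∀ s ∈ p, s = ((1 : ℤ), (1 : ℤ)) ∨ s = ((1 : ℤ), (-1 : ℤ)) ∨ s = ((2 : ℤ), (0 : ℤ))) ∧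
  (p.map Prod.fst).sum = 2 * n ∧
  (p.map Prod.snd).sum = 0 ∧
  (∀ k, 0 ≤ ((p.take k).map Prod.snd).sum) ∧
  ∀ i : ℕ, ∀ h : i < p.length,
    p.get ⟨i, h⟩ = ((2 : ℤ), (0 : ℤ)) → 0 < ((p.take i).map Prod.snd).sum

lemma flatten_map_pyramid_injective {ks ls : List ℕ} (hks : ∀ k ∈ ks, 1 ≤ k)
    (hls : ∀ k ∈ ls, 1 ≤ k) (h : (ks.map pyramid).flatten = (ls.map pyramid).flatten) :
    ks = ls := by
  induction ks generalizing ls with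
  | nil =>
    cases ls with
    | nil => rfl
    | cons b ls =>
      have := hls b (by simp)
      have := congrArg List.length h
      simp [pyramid] at this
      omega
  | cons a ks ih =>
    have ha := hks a (by simp)
    cases ls with
    | nil =>
      have := congrArg List.length h
      simp [pyramid] at this
      omega
    | cons b ls =>
      have hb := hls b (by simp)
      obtain ⟨a, rfl⟩ := Nat.exists_eq_add_of_le' ha
      obtain ⟨b, rfl⟩ := Nat.exists_eq_add_of_le' hb
      have hrun : ∀ (c : ℕ) (l : List ℕ),
          ((((c + 1) :: l).map pyramid).flatten.takeWhile id).length = c + 1 := by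
        intro c l
        simp [pyramid, List.replicate_succ (a := false)]
      have hab : a = b := by
        have := congrArg (fun l => (l.takeWhile id).length) h
        simp only [hrun] at this
        omega
      subst hab
      simp only [List.map_cons, List.flatten_cons, List.append_cancel_left_eq] at h
      rw [ih (fun k hk => hks k (by simp [hk])) (fun k hk => hls k (by simp [hk])) h]

lemma length_flatten_map_pyramid (ks : List ℕ) :
    (ks.map pyramid).flatten.length = 2 * ks.sum := by
  induction ks with
  | nil => rfl
  | cons k ks ih => simp only [List.map_cons, List.flatten_cons, List.length_append, ih,
      List.sum_cons, pyramid, List.length_replicate]; ring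

lemma card_pyramidConcat (k : ℕ) :
    Nat.card {c : List Bool // IsPyramidConcat c ∧ c.length = 2 * k} = 2 ^ (k - 1) := by
  rw [← composition_card, ← Nat.card_eq_fintype_card]
  symm
  refine Nat.card_congr (Equiv.ofBijective
    (fun c : Composition k => ⟨(c.blocks.map pyramid).flatten,
      ⟨c.blocks, fun _ hi => c.blocks_pos hi, rfl⟩, by
        rw [length_flatten_map_pyramid, c.blocks_sum]⟩) ⟨?_, ?_⟩)
  · intro c d h
    ext1
    exact flatten_map_pyramid_injective (fun _ hi => c.blocks_pos hi)
      (fun _ hi => d.blocks_pos hi) (Subtype.ext_iff.mp h)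
  · rintro ⟨_, ⟨ks, hks, rfl⟩, hlen⟩
    rw [length_flatten_map_pyramid] at hlen
    exact ⟨⟨ks, fun hi => hks _ hi, by omega⟩, rfl⟩

/-- Colourings of a sequence of ascents are chosen independently for the ascents. -/
lemma card_forall_mem_zip {α : Type*} (L : ℕ → α → Prop) (ks : List ℕ) :
    Nat.card {cs : List α // cs.length = ks.length ∧ ∀ q ∈ ks.zip cs, L q.1 q.2} =
      (ks.map fun k => Nat.card {c // L k c}).prod := by
  induction ks with
  | nil =>
    have : Unique {cs : List α // cs.length = ([] : List ℕ).length ∧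
        ∀ q ∈ ([] : List ℕ).zip cs, L q.1 q.2} :=
      { default := ⟨[], by simp⟩
        uniq := fun ⟨cs, h⟩ => Subtype.ext (by simpa using h) }
    simp
  | cons k ks ih =>
    rw [List.map_cons, List.prod_cons, ← ih, ← Nat.card_prod]
    symm
    refine Nat.card_congr (Equiv.ofBijective (fun x => ⟨x.1.1 :: x.2.1, by simpa using x.2.2.1, ?_⟩)
      ⟨?_, ?_⟩)
    · intro q hq
      rw [List.zip_cons_cons, List.mem_cons] at hq
      rcases hq with rfl | hq
      · exact x.1.2
      · exact x.2.2.2 q hq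
    · rintro ⟨⟨a, ha⟩, ⟨l, hl⟩⟩ ⟨⟨b, hb⟩, ⟨l', hl'⟩⟩ h
      simpa using h
    · rintro ⟨cs, hlen, hcs⟩
      cases cs with
      | nil => simp at hlen
      | cons c cs =>
        exact ⟨⟨⟨c, hcs (k, c) (by simp)⟩, ⟨cs, by simpa using hlen,
          fun q hq => hcs q (by simp [hq])⟩⟩, rfl⟩

/-- Words in up- and down-steps of length `m` leading from height `h` to the axis
without passing below it. -/
def dyckSuffixes : ℕ → ℕ → Finset (List Bool)
  | 0, 0 => {[]}
  | 0, _ + 1 => ∅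
  | m + 1, 0 => (dyckSuffixes m 1).image (List.cons true)
  | m + 1, h + 1 => (dyckSuffixes m (h + 2)).image (List.cons true) ∪
      (dyckSuffixes m h).image (List.cons false)

lemma mem_dyckSuffixes {m h : ℕ} {p : List Bool} :
    p ∈ dyckSuffixes m h ↔ p.length = m ∧
      (∀ k, (p.take k).count false ≤ h + (p.take k).count true) ∧
      h + p.count true = p.count false := by
  have hcons : ∀ (b : Bool) (p : List Bool) (h : ℕ),
      (∀ k, ((b :: p).take k).count false ≤ h + ((b :: p).take k).count true) ↔
        ∀ k, (b :: p.take k).count false ≤ h + (b :: p.take k).count true := by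
    intro b p h
    refine ⟨fun H k => H (k + 1), fun H k => ?_⟩
    cases k with
    | zero => simp
    | succ k => exact H k
  induction m generalizing h p with
  | zero =>
    cases h <;> simp [dyckSuffixes, List.length_eq_zero_iff] <;> rintro rfl <;> simp
  | succ m ih =>
    cases p with
    | nil => cases h <;> simp [dyckSuffixes]
    | cons b p =>
      rw [hcons]
      cases h <;> cases b <;> simp [dyckSuffixes, ih]
      · intro _ H
        have := H 0
        simp at this
      all_goals
        intro _
        refine and_congr (forall_congr' fun k => ?_) ?_ <;> omega

lemma sum_dyckSuffixes_succ_zero {M : Type*} [AddCommMonoid M] (m : ℕ) (f : List Bool → M) :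
    ∑ p ∈ dyckSuffixes (m + 1) 0, f p = ∑ p ∈ dyckSuffixes m 1, f (true :: p) := by
  rw [dyckSuffixes, sum_image (by simp)]

lemma sum_dyckSuffixes_succ_succ {M : Type*} [AddCommMonoid M] (m h : ℕ) (f : List Bool → M) :
    ∑ p ∈ dyckSuffixes (m + 1) (h + 1), f p =
      ∑ p ∈ dyckSuffixes m (h + 2), f (true :: p) + ∑ p ∈ dyckSuffixes m h, f (false :: p) := by
  rw [dyckSuffixes, sum_union, sum_image (by simp), sum_image (by simp)]
  rw [Finset.disjoint_left]
  simp only [mem_image, not_exists, not_and]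
  rintro _ ⟨_, _, rfl⟩
  simp

/-- The number of colourings of the ascents of a path. -/
def ascentWeight (p : List Bool) : ℕ :=
  ((ascentLengths p).map fun k => 2 ^ (k - 1)).prod

lemma ascentWeight_replicate (j : ℕ) : ascentWeight (List.replicate j true) = 2 ^ (j - 1) := by
  rw [ascentWeight, ascentLengths, List.splitOn_eq_singleton (by simp)]
  cases j <;> simp

lemma ascentWeight_replicate_append_false (j : ℕ) (p : List Bool) :
    ascentWeight (List.replicate j true ++ false :: p) = 2 ^ (j - 1) * ascentWeight p := by
  rw [ascentWeight, ascentLengths, List.splitOn_append_cons_self_of_not_mem (by simp)]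
  cases j <;> simp [ascentWeight, ascentLengths]

lemma card_colouredDyck (n : ℕ) :
    Nat.card (ColouredDyck n (fun k c => IsPyramidConcat c ∧ c.length = 2 * k)) =
      ∑ p ∈ dyckSuffixes (2 * n) 0, ascentWeight p := by
  let L : ℕ → List Bool → Prop := fun k c => IsPyramidConcat c ∧ c.length = 2 * k
  let F : dyckSuffixes (2 * n) 0 → Type := fun p =>
    {cs : List (List Bool) // cs.length = (ascentLengths p.1).length ∧
      ∀ q ∈ (ascentLengths p.1).zip cs, L q.1 q.2}
  have hF (p : dyckSuffixes (2 * n) 0) : Nat.card (F p) = ascentWeight p := by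
    rw [card_forall_mem_zip, ascentWeight]
    simp only [L, card_pyramidConcat]
  have (p : dyckSuffixes (2 * n) 0) : Finite (F p) := Nat.finite_of_card_ne_zero (by
    rw [hF, ascentWeight]
    exact List.prod_ne_zero (by simp))
  have e : ColouredDyck n L ≃ Σ p, F p :=
    { toFun := fun x => ⟨⟨x.1.1, mem_dyckSuffixes.2 ⟨x.2.2.1, by simpa using x.2.1.1,
        by simpa using x.2.1.2⟩⟩, ⟨x.1.2, x.2.2.2⟩⟩
      invFun := fun y => ⟨(y.1.1, y.2.1), by
        obtain ⟨h₁, h₂, h₃⟩ := mem_dyckSuffixes.1 y.1.2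
        exact ⟨⟨by simpa using h₂, by simpa using h₃⟩, h₁, y.2.2⟩⟩
      left_inv := fun _ => rfl
      right_inv := fun _ => rfl }
  rw [Nat.card_congr e, Nat.card_sigma, Finset.sum_congr rfl fun p _ => hF p,
    Finset.sum_coe_sort _ ascentWeight]

/-- The large Schröder generating function in the variable `X ^ 2`. -/
noncomputable def largeSchroderSq : ℚ⟦X⟧ :=
  expand 2 two_ne_zero (PowerSeries.map (Nat.castRingHom ℚ) largeSchroderSeries)

lemma largeSchroderSq_eq : largeSchroderSq =
    1 + X ^ 2 * largeSchroderSq + X ^ 2 * largeSchroderSq ^ 2 := by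
  have := congrArg
    (fun f => expand 2 two_ne_zero (PowerSeries.map (Nat.castRingHom ℚ) f))
    largeSchroderSeries_eq_one_add_X_mul_largeSchroderSeries_add_X_mul_largeSchroderSeries_sq
  simpa only [map_add, map_mul, map_pow, map_one, map_X, expand_X] using! this

/-- The little Schröder generating function in the variable `X ^ 2`. -/
noncomputable def littleSchroderSq : ℚ⟦X⟧ :=
  C (1 / 2) * (1 + largeSchroderSq)

lemma two_mul_littleSchroderSq : 2 * littleSchroderSq = 1 + largeSchroderSq := by
  have : (2 : ℚ⟦X⟧) * C (1 / 2) = 1 := by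
    rw [← map_ofNat (C : ℚ →+* ℚ⟦X⟧), ← map_mul]
    norm_num
  rw [littleSchroderSq, ← mul_assoc, this, one_mul]

lemma littleSchroderSq_eq : littleSchroderSq =
    1 + X ^ 2 * (largeSchroderSq * littleSchroderSq) := by
  have h : (2 : ℚ⟦X⟧) ≠ 0 := by
    rw [← map_ofNat (C : ℚ →+* ℚ⟦X⟧)]
    simp
  refine mul_left_cancel₀ h ?_
  linear_combination (1 - X ^ 2 * largeSchroderSq) * two_mul_littleSchroderSq +
    largeSchroderSq_eq

lemma constantCoeff_largeSchroderSq : constantCoeff largeSchroderSq = 1 := by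
  rw [largeSchroderSq_eq]
  simp

lemma constantCoeff_littleSchroderSq : constantCoeff littleSchroderSq = 1 := by
  rw [littleSchroderSq_eq]
  simp

/-- The generating function of coloured paths from height `h` to the axis. -/
noncomputable def pathSeries (h : ℕ) : ℚ⟦X⟧ :=
  X ^ h * littleSchroderSq ^ (h + 1)

/-- The generating function of coloured paths from height `h` to the axis whose first step
is preceded by an up-step. -/
noncomputable def ascentSeries (h : ℕ) : ℚ⟦X⟧ :=
  X ^ h * (largeSchroderSq * littleSchroderSq ^ h)

lemma pathSeries_zero : pathSeries 0 = 1 + X * ascentSeries 1 := by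
  simp only [pathSeries, ascentSeries]
  linear_combination littleSchroderSq_eq

lemma pathSeries_succ (h : ℕ) :
    pathSeries (h + 1) = X * (ascentSeries (h + 2) + pathSeries h) := by
  simp only [pathSeries, ascentSeries]
  linear_combination X ^ (h + 1) * littleSchroderSq ^ (h + 1) * littleSchroderSq_eq

lemma largeSchroderSq_eq_littleSchroderSq :
    largeSchroderSq = 1 + 2 * X ^ 2 * (largeSchroderSq * littleSchroderSq) := by
  linear_combination 2 * littleSchroderSq_eq - two_mul_littleSchroderSq

lemma ascentSeries_zero : ascentSeries 0 = 1 + X * (2 * ascentSeries 1) := by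
  simp only [ascentSeries]
  linear_combination largeSchroderSq_eq_littleSchroderSq

lemma ascentSeries_succ (h : ℕ) :
    ascentSeries (h + 1) = X * (2 * ascentSeries (h + 2) + pathSeries h) := by
  simp only [pathSeries, ascentSeries]
  linear_combination X ^ (h + 1) * littleSchroderSq ^ (h + 1) * largeSchroderSq_eq_littleSchroderSq

lemma sum_ascentWeight_dyckSuffixes (m h : ℕ) :
    ((∑ p ∈ dyckSuffixes m h, ascentWeight p : ℕ) : ℚ) = coeff m (pathSeries h) ∧
      ∀ j, ((∑ p ∈ dyckSuffixes m h,
        ascentWeight (List.replicate (j + 1) true ++ p) : ℕ) : ℚ) =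
          2 ^ j * coeff m (ascentSeries h) := by
  have hrep : ∀ (j : ℕ) (p : List Bool),
      List.replicate j true ++ true :: p = List.replicate (j + 1) true ++ p := by
    intro j p
    rw [List.replicate_succ', List.append_assoc, List.singleton_append]
  have hup : ∀ p, ascentWeight (true :: p) = ascentWeight (List.replicate (0 + 1) true ++ p) :=
    fun _ => rfl
  have hdown : ∀ p, ascentWeight (false :: p) = ascentWeight p :=
    fun p => by simpa using ascentWeight_replicate_append_false 0 p
  induction m generalizing h with
  | zero =>
    have hnil : ascentWeight [] = 1 := ascentWeight_replicate 0
    cases h with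
    | zero =>
      simp [dyckSuffixes, pathSeries, ascentSeries, hnil, ascentWeight_replicate,
        constantCoeff_largeSchroderSq, constantCoeff_littleSchroderSq]
    | succ h => simp [dyckSuffixes, pathSeries, ascentSeries]
  | succ m ih =>
    cases h with
    | zero =>
      simp only [sum_dyckSuffixes_succ_zero, hup, hrep, (ih 1).2, pathSeries_zero,
        ascentSeries_zero, map_add, coeff_succ_X_mul, coeff_one]
      simp [two_mul, pow_succ, mul_add, add_mul, mul_two]
    | succ h =>
      simp only [sum_dyckSuffixes_succ_succ, hup, hdown, hrep, Nat.cast_add, (ih (h + 2)).2,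
        ascentWeight_replicate_append_false, ← Finset.mul_sum, Nat.cast_mul, (ih h).1,
        pathSeries_succ h, ascentSeries_succ h, map_add, coeff_succ_X_mul]
      simp [two_mul, pow_succ, mul_add, add_mul, mul_two]

/-- A path with steps `(1,1)`, `(1,-1)` and `(2,0)` of length `m` from height `h` to the axis,
never below it and without `(2,0)`-steps on it. -/
def IsSchroederSuffix (m h : ℤ) (p : List (ℤ × ℤ)) : Prop :=
  (∀ s ∈ p, s = ((1 : ℤ), (1 : ℤ)) ∨ s = ((1 : ℤ), (-1 : ℤ)) ∨ s = ((2 : ℤ), (0 : ℤ))) ∧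
  (p.map Prod.fst).sum = m ∧
  h + (p.map Prod.snd).sum = 0 ∧
  (∀ k, 0 ≤ h + ((p.take k).map Prod.snd).sum) ∧
  ∀ i : ℕ, ∀ hi : i < p.length,
    p.get ⟨i, hi⟩ = ((2 : ℤ), (0 : ℤ)) → 0 < h + ((p.take i).map Prod.snd).sum

lemma IsSchroederSuffix.height_nonneg {m h : ℤ} {p : List (ℤ × ℤ)}
    (hp : IsSchroederSuffix m h p) : 0 ≤ h := by
  simpa using hp.2.2.2.1 0

lemma IsSchroederSuffix.length_nonneg {m h : ℤ} {p : List (ℤ × ℤ)}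
    (hp : IsSchroederSuffix m h p) : 0 ≤ m := by
  rw [← hp.2.1]
  refine List.sum_nonneg fun x hx => ?_
  obtain ⟨s, hs, rfl⟩ := List.mem_map.1 hx
  rcases hp.1 s hs with rfl | rfl | rfl <;> norm_num

lemma isSchroederSuffix_nil {m h : ℤ} : IsSchroederSuffix m h [] ↔ m = 0 ∧ h = 0 := by
  simp only [IsSchroederSuffix]
  simp
  omega

lemma isSchroederSuffix_cons {m h : ℤ} {s : ℤ × ℤ} {p : List (ℤ × ℤ)} :
    IsSchroederSuffix m h (s :: p) ↔
      (s = (1, 1) ∧ 0 ≤ h ∧ IsSchroederSuffix (m - 1) (h + 1) p) ∨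
      (s = (1, -1) ∧ IsSchroederSuffix (m - 1) (h - 1) p) ∨
      (s = (2, 0) ∧ 0 < h ∧ IsSchroederSuffix (m - 2) h p) := by
  have key : IsSchroederSuffix m h (s :: p) ↔
      (s = (1, 1) ∨ s = (1, -1) ∨ s = (2, 0)) ∧ 0 ≤ h ∧ (s = (2, 0) → 0 < h) ∧
        IsSchroederSuffix (m - s.1) (h + s.2) p := by
    constructor
    · rintro ⟨h₁, h₂, h₃, h₄, h₅⟩
      simp only [List.map_cons, List.sum_cons] at h₂ h₃
      refine ⟨h₁ s (by simp), by simpa using h₄ 0,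
        fun hs => by simpa using h₅ 0 (by simp) (by simpa using hs),
        fun t ht => h₁ t (by simp [ht]), by omega, by omega,
        fun k => by simpa [add_assoc] using h₄ (k + 1),
        fun i hi hL => by simpa [add_assoc] using h₅ (i + 1) (by simpa using hi) hL⟩
    · rintro ⟨hs, hh, hL, h₁, h₂, h₃, h₄, h₅⟩
      refine ⟨?_, ?_, ?_, ?_, ?_⟩
      · rw [List.forall_mem_cons]
        exact ⟨hs, h₁⟩
      · simp only [List.map_cons, List.sum_cons]
        omega
      · simp only [List.map_cons, List.sum_cons]
        omega
      · rintro (_ | k)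
        · simpa using hh
        · simpa [add_assoc] using h₄ k
      · rintro (_ | i) hi hsi
        · simpa using hL hsi
        · simpa [add_assoc] using h₅ i (by simpa using hi) hsi
  rw [key]
  constructor
  · rintro ⟨rfl | rfl | rfl, hh, hL, hp⟩
    · exact Or.inl ⟨rfl, hh, hp⟩
    · exact Or.inr (Or.inl ⟨rfl, hp⟩)
    · exact Or.inr (Or.inr ⟨rfl, hL rfl, by simpa using hp⟩)
  · rintro (⟨rfl, hh, hp⟩ | ⟨rfl, hp⟩ | ⟨rfl, hh, hp⟩)
    · exact ⟨by simp, hh, by simp, hp⟩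
    · exact ⟨by simp, by linarith [hp.height_nonneg], by simp, hp⟩
    · exact ⟨by simp, hh.le, fun _ => hh, by simpa using hp⟩

/-- The finite set of paths satisfying `IsSchroederSuffix m h`. -/
def schroederSuffixes : ℕ → ℕ → Finset (List (ℤ × ℤ))
  | 0, 0 => {[]}
  | 0, _ + 1 => ∅
  | m + 1, 0 => (schroederSuffixes m 1).image (List.cons (1, 1))
  | 1, h + 1 => (schroederSuffixes 0 (h + 2)).image (List.cons (1, 1)) ∪
      (schroederSuffixes 0 h).image (List.cons (1, -1))
  | m + 2, h + 1 => (schroederSuffixes (m + 1) (h + 2)).image (List.cons (1, 1)) ∪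
      ((schroederSuffixes (m + 1) h).image (List.cons (1, -1)) ∪
        (schroederSuffixes m (h + 1)).image (List.cons (2, 0)))

lemma mem_schroederSuffixes {m h : ℕ} {p : List (ℤ × ℤ)} :
    p ∈ schroederSuffixes m h ↔ IsSchroederSuffix m h p := by
  have hneg : ∀ {m h : ℤ} {p : List (ℤ × ℤ)}, (m < 0 ∨ h < 0) → ¬ IsSchroederSuffix m h p :=
    fun hmh hp => by
      have := hp.height_nonneg
      have := hp.length_nonneg
      omega
  induction p generalizing m h with
  | nil =>
    rw [isSchroederSuffix_nil]
    rcases m with _ | _ | m <;> cases h <;> simp [schroederSuffixes] <;> omega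
  | cons s p ih =>
    rw [isSchroederSuffix_cons]
    have hcons (u : ℤ × ℤ) (S : Finset (List (ℤ × ℤ))) :
        s :: p ∈ S.image (List.cons u) ↔ s = u ∧ p ∈ S := by
      rw [mem_image]
      grind
    have height_pos (a : ℕ) : 0 ≤ (a : ℤ) + 1 := by positivity
    have add_two (a : ℕ) : (a : ℤ) + 1 + 1 = a + 2 := by ring
    have sub_two (a : ℕ) : (a : ℤ) + 2 - 2 = a := by ring
    have sub_one (a : ℕ) : (a : ℤ) + 2 - 1 = a + 1 := by ring
    rcases m with _ | _ | m <;> rcases h with _ | h <;> rw [schroederSuffixes] <;>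
      simp [-mem_image, hcons, ih, hneg, height_pos, add_two, sub_two, sub_one]

/-- The generating function of little Schröder path suffixes starting at height `h`. -/
noncomputable def suffixSeries (h : ℕ) : ℚ⟦X⟧ :=
  X ^ h * (largeSchroderSq ^ h * littleSchroderSq)

lemma suffixSeries_zero : suffixSeries 0 = 1 + X * suffixSeries 1 := by
  simp only [suffixSeries]
  linear_combination littleSchroderSq_eq

lemma suffixSeries_succ (h : ℕ) : suffixSeries (h + 1) =
    X * (suffixSeries (h + 2) + (suffixSeries h + X * suffixSeries (h + 1))) := by
  simp only [suffixSeries]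
  linear_combination X ^ (h + 1) * largeSchroderSq ^ h * littleSchroderSq * largeSchroderSq_eq

lemma card_schroederSuffixes (m h : ℕ) :
    ((schroederSuffixes m h).card : ℚ) = coeff m (suffixSeries h) := by
  have hcard (u : ℤ × ℤ) (S : Finset (List (ℤ × ℤ))) : (S.image (List.cons u)).card = S.card :=
    card_image_of_injective _ (List.cons_injective)
  have hdisj {u v : ℤ × ℤ} (huv : u ≠ v) (S T : Finset (List (ℤ × ℤ))) :
      Disjoint (S.image (List.cons u)) (T.image (List.cons v)) := by
    rw [Finset.disjoint_left]
    simp only [mem_image, not_exists, not_and]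
    rintro _ ⟨_, _, rfl⟩ _ _ h
    exact huv (List.cons.inj h).1.symm
  induction m, h using schroederSuffixes.induct with
  | case1 => simp [schroederSuffixes, suffixSeries, constantCoeff_littleSchroderSq]
  | case2 h => simp [schroederSuffixes, suffixSeries]
  | case3 m ih =>
    rw [schroederSuffixes, hcard, ih, suffixSeries_zero, map_add, coeff_succ_X_mul, coeff_one,
      if_neg m.succ_ne_zero, zero_add]
  | case4 h ih₁ ih₂ =>
    rw [schroederSuffixes, card_union_of_disjoint (hdisj (by decide) _ _), hcard, hcard,
      suffixSeries_succ, show (1 : ℕ) = 0 + 1 from rfl, coeff_succ_X_mul, map_add, map_add, Nat.cast_add, ih₁, ih₂,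
      coeff_zero_X_mul, add_zero]
  | case5 m h ih₁ ih₂ ih₃ =>
    rw [schroederSuffixes, card_union_of_disjoint (disjoint_union_right.2
        ⟨hdisj (by decide) _ _, hdisj (by decide) _ _⟩),
      card_union_of_disjoint (hdisj (by decide) _ _), hcard, hcard, hcard, suffixSeries_succ,
      coeff_succ_X_mul, map_add, map_add, coeff_succ_X_mul, Nat.cast_add, Nat.cast_add,
      ih₁, ih₂, ih₃]

lemma card_littleSchroederPath (n : ℕ) :
    Nat.card {p : List (ℤ × ℤ) // IsLittleSchroederPath n p} =
      (schroederSuffixes (2 * n) 0).card := by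
  rw [← Fintype.card_coe, ← Nat.card_eq_fintype_card]
  refine Nat.card_congr (Equiv.subtypeEquivRight fun p => ?_)
  rw [mem_schroederSuffixes]
  simp [IsSchroederSuffix, IsLittleSchroederPath]

/-- Dyck paths of length `2n` with each `k`-ascent coloured by a
concatenation of pyramids of total length `2k` are equinumerous with little
Schröder paths of length `2n`. -/
theorem coloured_dyck_eq_little_schroeder (n : ℕ) :
    Nat.card (ColouredDyck n
        (fun k c => IsPyramidConcat c ∧ c.length = 2 * k)) =
      Nat.card {p : List (ℤ × ℤ) // IsLittleSchroederPath n p} := by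
  rw [card_colouredDyck, card_littleSchroederPath]
  have h : pathSeries 0 = suffixSeries 0 := by simp [pathSeries, suffixSeries]
  exact_mod_cast (sum_ascentWeight_dyckSuffixes (2 * n) 0).1.trans
    ((congrArg (coeff (2 * n)) h).trans (card_schroederSuffixes (2 * n) 0).symm)
end
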